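/- (Hypersurface Section Formula) Let I be a Cohen-Macaulay R-ideal of positive grade and let x ∈ R be regular on R and on R/I. Then ∫(I + (x)) = (∫I) + (x). -/

import Mathlib

open RingTheory IsLocalRing

/-- A proper ideal generated by a regular sequence is a complete intersection. -/
def IsCompleteIntersectionIdeal (R : Type) [CommRing R] (I : Ideal R) : Prop :=
  I ≠ ⊤ ∧ ∃ rs : List R, RingTheory.Sequence.IsRegular R rs ∧ Ideal.ofList rs = I

/-- Two proper ideals are directly linked if there is a complete intersection
`c ⊆ I ⊓ J` with `I = c : J` and `J = c : I`. -/
def IsDirectlyLinked (R : Type) [CommRing R] (I J : Ideal R) : Prop :=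
  I ≠ ⊤ ∧ J ≠ ⊤ ∧ ∃ c : Ideal R, IsCompleteIntersectionIdeal R c ∧ c ≤ I ⊓ J ∧
    Submodule.colon c J = I ∧ Submodule.colon c I = J

/-- The linkage (liaison) equivalence: the equivalence relation generated by direct linkage. -/
def InSameLinkageClass (R : Type) [CommRing R] (I J : Ideal R) : Prop :=
  Relation.EqvGen (IsDirectlyLinked R) I J

/-- An ideal is licci if its linkage class contains a complete intersection. -/
def Licci (R : Type) [CommRing R] (I : Ideal R) : Prop :=
  ∃ J, InSameLinkageClass R I J ∧ IsCompleteIntersectionIdeal R J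

open Classical in
/-- `∫ I` : the sum of all ideals in the linkage class of `I` if `I` is not licci,
and the unit ideal otherwise. -/
noncomputable def intLink (R : Type) [CommRing R] (I : Ideal R) : Ideal R :=
  if Licci R I then ⊤ else sSup {J : Ideal R | InSameLinkageClass R I J}

/-- An ideal is maximal in its linkage class if it contains every ideal in its linkage class. -/
def MaximalInLinkageClass (R : Type) [CommRing R] (I : Ideal R) : Prop :=
  ∀ J, InSameLinkageClass R I J → J ≤ I

/-- Linked in `n` steps. -/
def LinkedInSteps (R : Type) [CommRing R] : ℕ → Ideal R → Ideal R → Prop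
  | 0, I, J => I = J
  | (n+1), I, J => ∃ K, IsDirectlyLinked R I K ∧ LinkedInSteps R n K J

/-- The grade of an ideal: the supremum of lengths of regular sequences contained in it. -/
noncomputable def gradeOf (R : Type) [CommRing R] (I : Ideal R) : ℕ :=
  sSup {n : ℕ | ∃ rs : List R, rs.length = n ∧ (∀ r ∈ rs, r ∈ I) ∧
    RingTheory.Sequence.IsRegular R rs}

/-- A Noetherian local ring is Cohen-Macaulay if its depth (the grade of its maximal ideal)
equals its Krull dimension. -/
def IsCMLocalRing (A : Type) [CommRing A] [IsLocalRing A] : Prop :=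
  ringKrullDim A = (gradeOf A (maximalIdeal A) : WithBot (WithTop ℕ))

/-- An ideal `I` of `R` is a Cohen-Macaulay ideal if `R/I` is a Cohen-Macaulay local ring. -/
def IsCMIdeal (R : Type) [CommRing R] (I : Ideal R) : Prop :=
  ∃ h : IsLocalRing (R ⧸ I), @IsCMLocalRing (R ⧸ I) _ h

/-- A Noetherian local ring is Gorenstein if it is Cohen-Macaulay and some ideal generated
by a regular sequence and primary to the maximal ideal is irreducible. -/
def IsGorensteinLocalRing (A : Type) [CommRing A] [IsLocalRing A] : Prop :=
  IsCMLocalRing A ∧ ∃ rs : List A, RingTheory.Sequence.IsRegular A rs ∧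
    (Ideal.ofList rs).radical = maximalIdeal A ∧ InfIrred (Ideal.ofList rs)

/-- `z` is a nonzerodivisor modulo the ideal `I`. -/
def RegMod {A : Type*} [CommRing A] (I : Ideal A) (z : A) : Prop :=
  ∀ a, z * a ∈ I → a ∈ I

section Elementary

variable {A : Type*} [CommRing A]

lemma mem_sup_span {I : Ideal A} {z a : A} :
    a ∈ I ⊔ Ideal.span {z} ↔ ∃ b, a - z * b ∈ I := by
  rw [Submodule.mem_sup]
  constructor
  · rintro ⟨i, hi, y, hy, rfl⟩
    obtain ⟨b, rfl⟩ := Ideal.mem_span_singleton'.1 hy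
    exact ⟨b, by convert hi using 1; ring⟩
  · rintro ⟨b, hb⟩
    exact ⟨_, hb, z * b, Ideal.mul_mem_right _ _ (Ideal.mem_span_singleton_self z), by ring⟩

lemma mem_ideal_colon {I J : Ideal A} {a : A} : a ∈ I.colon (J : Set A) ↔ ∀ j ∈ J, a * j ∈ I := by
  simp [Submodule.mem_colon]

lemma mem_ideal_colon_singleton {I : Ideal A} {s a : A} : a ∈ I.colon {s} ↔ a * s ∈ I := by
  simp [Submodule.mem_colon]

lemma regMod_iff_isSMulRegular {I : Ideal A} {z : A} : RegMod I z ↔ IsSMulRegular (A ⧸ I) z := by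
  rw [isSMulRegular_quotient_iff_mem_of_smul_mem]
  rfl

lemma RegMod.colon {I : Ideal A} {z : A} (h : RegMod I z) (S : Set A) : RegMod (I.colon S) z := by
  intro a ha
  rw [Submodule.mem_colon] at ha ⊢
  intro s hs
  apply h
  have := ha s hs
  simp only [smul_eq_mul] at this ⊢
  rwa [← mul_assoc]

lemma RegMod.add {I : Ideal A} {z i : A} (h : RegMod I z) (hi : i ∈ I) : RegMod I (z + i) := by
  intro a ha
  apply h
  have := I.sub_mem ha (I.mul_mem_right a hi)
  convert this using 1; ring

lemma sup_span_add {I : Ideal A} {z i : A} (hi : i ∈ I) :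
    I ⊔ Ideal.span {z + i} = I ⊔ Ideal.span {z} := by
  ext a
  simp only [mem_sup_span]
  constructor
  · rintro ⟨b, hb⟩
    exact ⟨b, by convert I.add_mem hb (I.mul_mem_right b hi) using 1; ring⟩
  · rintro ⟨b, hb⟩
    exact ⟨b, by convert I.sub_mem hb (I.mul_mem_right b hi) using 1; ring⟩

/-- Prime avoidance for cosets. -/
lemma exists_add_notMem_primes {𝒮 : Set (Ideal A)} (hfin : 𝒮.Finite)
    (hp : ∀ P ∈ 𝒮, P.IsPrime) (J : Ideal A) (x : A) (h : ∀ P ∈ 𝒮, x ∈ P → ¬ J ≤ P) :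
    ∃ i ∈ J, ∀ P ∈ 𝒮, x + i ∉ P := by
  set T : Set (Ideal A) := {P | Maximal (· ∈ 𝒮) P} with hT
  have hTS : T ⊆ 𝒮 := fun P hP => hP.prop
  have hTfin : T.Finite := hfin.subset hTS
  set T0 : Set (Ideal A) := {P ∈ T | x ∉ P}
  set T1 : Set (Ideal A) := {P ∈ T | x ∈ P}
  have hT0 : T0.Finite := hTfin.subset fun _ h => h.1
  have hT1 : T1.Finite := hTfin.subset fun _ h => h.1
  set K : Ideal A := J ⊓ hT0.toFinset.inf id with hK
  have hKP : ∀ P ∈ T1, ¬ K ≤ P := by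
    intro P hP hle
    have hPp := hp P (hTS hP.1)
    rcases hPp.inf_le.1 hle with h1 | h1
    · exact h P (hTS hP.1) hP.2 h1
    · obtain ⟨Q, hQ, hQP⟩ := (Ideal.IsPrime.inf_le' hPp).1 h1
      have hQ' : Q ∈ T0 := by simpa using hQ
      have : Q = P := hQ'.1.eq_of_le (hTS hP.1) hQP
      exact hQ'.2 (this ▸ hP.2)
  have hex : ∃ i ∈ K, ∀ P ∈ T1, i ∉ P := by
    by_contra hcon
    push Not at hcon
    have hsub : (K : Set A) ⊆ ⋃ P ∈ T1, (id P : Ideal A) := by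
      intro i hi
      obtain ⟨P, hP, hiP⟩ := hcon i hi
      exact Set.mem_biUnion hP hiP
    obtain ⟨P, hP, hle⟩ := (Ideal.subset_union_prime_finite hT1 (f := id) ⊥ ⊥
      (fun P hP _ _ => hp P (hTS hP.1))).1 hsub
    exact hKP P hP hle
  obtain ⟨i, hiK, hi⟩ := hex
  refine ⟨i, hiK.1, fun P hP hmem => ?_⟩
  obtain ⟨Q, hPQ, hQ⟩ := hfin.exists_le_maximal hP
  have hmemQ := hPQ hmem
  by_cases hxQ : x ∈ Q
  · exact hi Q ⟨hQ, hxQ⟩ (by simpa using Q.sub_mem hmemQ hxQ)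
  · have hQ0 : Q ∈ hT0.toFinset := hT0.mem_toFinset.2 ⟨hQ, hxQ⟩
    have : i ∈ Q := (Finset.inf_le hQ0 : _ ≤ id Q) hiK.2
    exact hxQ (by simpa using Q.sub_mem hmemQ this)

variable [IsNoetherianRing A]

lemma regMod_iff_notMem_associatedPrimes {I : Ideal A} {z : A} :
    RegMod I z ↔ ∀ P ∈ associatedPrimes A (A ⧸ I), z ∉ P := by
  have h := biUnion_associatedPrimes_eq_compl_regular A (A ⧸ I)
  rw [regMod_iff_isSMulRegular]
  have h2 : z ∈ ⋃ p ∈ associatedPrimes A (A ⧸ I), (p : Set A) ↔ ¬ IsSMulRegular (A ⧸ I) z := by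
    rw [h]; rfl
  rw [← not_iff_not, ← h2]
  simp

lemma exists_colon_singleton_of_mem_associatedPrimes {I P : Ideal A}
    (hP : P ∈ associatedPrimes A (A ⧸ I)) : ∃ s, s ∉ I ∧ P = I.colon {s} := by
  obtain ⟨hp, y, hy⟩ := isAssociatedPrime_iff.1 hP
  obtain ⟨s, rfl⟩ := Ideal.Quotient.mk_surjective y
  have key : P = I.colon {s} := by
    rw [hy]
    ext a
    rw [Submodule.mem_colon_singleton, mem_ideal_colon_singleton, Submodule.mem_bot,
      ← Ideal.Quotient.eq_zero_iff_mem]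
    rfl
  refine ⟨s, fun hs => hp.ne_top ?_, key⟩
  rw [key, Ideal.eq_top_iff_one, mem_ideal_colon_singleton]
  simpa using hs

end Elementary

section Local

variable {A : Type*} [CommRing A] [IsLocalRing A]

/-- The ideal `I` admits a chain of `n` successive regular elements of the maximal ideal, at the
end of which the property `B` holds. -/
def Reach (B : Ideal A → Prop) : ℕ → Ideal A → Prop
  | 0, I => B I
  | n + 1, I => ∃ z ∈ maximalIdeal A, RegMod I z ∧ Reach B n (I ⊔ Ideal.span {z})

/-- `A ⧸ I` has depth at least `n`. -/
abbrev DepthGE (n : ℕ) (I : Ideal A) : Prop := Reach (fun _ => True) n I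

lemma Reach.mono {B C : Ideal A → Prop} (h : ∀ I, B I → C I) {n : ℕ} {I : Ideal A}
    (hI : Reach B n I) : Reach C n I := by
  induction n generalizing I with
  | zero => exact h I hI
  | succ n ih =>
    obtain ⟨z, hz, hr, hn⟩ := hI
    exact ⟨z, hz, hr, ih hn⟩

lemma Reach.depthGE {B : Ideal A → Prop} {n : ℕ} {I : Ideal A}
    (hI : Reach B n I) : DepthGE n I := hI.mono fun _ _ => trivial

lemma DepthGE.exists_regMod {n : ℕ} {I : Ideal A} (h : DepthGE (n + 1) I) :
    ∃ z ∈ maximalIdeal A, RegMod I z :=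
  let ⟨z, hz, hr, _⟩ := h; ⟨z, hz, hr⟩

variable [IsNoetherianRing A]

/-- Nakayama: if everything in `J` lies in `I + zJ`, then `J ≤ I`. -/
lemma le_of_forall_exists_sub_mem {I J : Ideal A} {z : A} (hz : z ∈ maximalIdeal A)
    (h : ∀ a ∈ J, ∃ b ∈ J, a - z * b ∈ I) : J ≤ I := by
  refine Submodule.le_of_le_smul_of_le_jacobson_bot (I := maximalIdeal A)
    (IsNoetherian.noetherian J) (IsLocalRing.maximalIdeal_le_jacobson _) fun a ha => ?_
  obtain ⟨b, hb, hab⟩ := h a ha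
  rw [← sub_add_cancel a (z * b)]
  exact Submodule.add_mem_sup hab (Submodule.smul_mem_smul hz hb)

lemma RegMod.swap_left {I : Ideal A} {y z : A} (hy : RegMod I y)
    (hym : y ∈ maximalIdeal A) (hz : RegMod (I ⊔ Ideal.span {y}) z) : RegMod I z := by
  have : I.colon {z} ≤ I := by
    refine le_of_forall_exists_sub_mem hym fun a ha => ?_
    rw [mem_ideal_colon_singleton] at ha
    obtain ⟨b, hb⟩ := mem_sup_span.1 (hz a (Ideal.mem_sup_left (by rwa [mul_comm])))
    refine ⟨b, ?_, hb⟩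
    rw [mem_ideal_colon_singleton]
    apply hy
    convert I.sub_mem ha (I.mul_mem_left z hb) using 1; ring
  intro a ha
  exact this (by rwa [mem_ideal_colon_singleton, mul_comm])

omit [IsLocalRing A] [IsNoetherianRing A] in
lemma RegMod.swap_right {I : Ideal A} {y z : A} (hy : RegMod I y)
    (hz : RegMod (I ⊔ Ideal.span {y}) z) : RegMod (I ⊔ Ideal.span {z}) y := by
  intro a ha
  obtain ⟨b, hb⟩ := mem_sup_span.1 ha
  have : z * b ∈ I ⊔ Ideal.span {y} := mem_sup_span.2 ⟨a, by
    convert I.neg_mem hb using 1; ring⟩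
  obtain ⟨c, hc⟩ := mem_sup_span.1 (hz b this)
  refine mem_sup_span.2 ⟨c, hy _ ?_⟩
  convert I.add_mem hb (I.mul_mem_left z hc) using 1; ring

/-- A common regular element modulo two ideals of positive depth. -/
lemma exists_regMod_both {I J : Ideal A} (hI : ∃ z ∈ maximalIdeal A, RegMod I z)
    (hJ : ∃ z ∈ maximalIdeal A, RegMod J z) :
    ∃ z ∈ maximalIdeal A, RegMod I z ∧ RegMod J z := by
  have hfin : (associatedPrimes A (A ⧸ I) ∪ associatedPrimes A (A ⧸ J)).Finite :=
    (associatedPrimes.finite A _).union (associatedPrimes.finite A _)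
  obtain ⟨i, hi, h⟩ := exists_add_notMem_primes hfin
    (by rintro P (hP | hP) <;> exact hP.1) (maximalIdeal A) 0 (by
      rintro P (hP | hP) - hle
      · obtain ⟨z, hz, hr⟩ := hI
        exact regMod_iff_notMem_associatedPrimes.1 hr P hP (hle hz)
      · obtain ⟨z, hz, hr⟩ := hJ
        exact regMod_iff_notMem_associatedPrimes.1 hr P hP (hle hz))
  simp only [zero_add] at h
  exact ⟨i, hi, regMod_iff_notMem_associatedPrimes.2 fun P hP => h P (Or.inl hP),
    regMod_iff_notMem_associatedPrimes.2 fun P hP => h P (Or.inr hP)⟩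

lemma exists_regMod_or_exists_socle (I : Ideal A) : (∃ z ∈ maximalIdeal A, RegMod I z) ∨
    ∃ a, a ∉ I ∧ ∀ r ∈ maximalIdeal A, r * a ∈ I := by
  by_cases h : ∃ P ∈ associatedPrimes A (A ⧸ I), maximalIdeal A ≤ P
  · obtain ⟨P, hP, hle⟩ := h
    obtain ⟨s, hs, rfl⟩ := exists_colon_singleton_of_mem_associatedPrimes hP
    exact Or.inr ⟨s, hs, fun r hr => mem_ideal_colon_singleton.1 (hle hr)⟩
  · push Not at h
    obtain ⟨i, hi, h⟩ := exists_add_notMem_primes (associatedPrimes.finite A (A ⧸ I))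
      (fun P hP => hP.1) (maximalIdeal A) 0 (fun P hP _ => h P hP)
    simp only [zero_add] at h
    exact Or.inl ⟨i, hi, regMod_iff_notMem_associatedPrimes.2 h⟩

omit [IsNoetherianRing A] in
/-- The comparison of socles modulo two regular elements. -/
lemma exists_socle_transfer {I : Ideal A} {y z a : A} (hz : RegMod I z)
    (ha : ∀ r ∈ maximalIdeal A, r * a ∈ I ⊔ Ideal.span {z}) (hy : y ∈ maximalIdeal A) :
    ∃ b, y * a - z * b ∈ I ∧ ∀ r ∈ maximalIdeal A, r * b ∈ I ⊔ Ideal.span {y} := by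
  obtain ⟨b, hb⟩ := mem_sup_span.1 (ha y hy)
  refine ⟨b, hb, fun r hr => ?_⟩
  obtain ⟨c, hc⟩ := mem_sup_span.1 (ha r hr)
  refine mem_sup_span.2 ⟨c, hz _ ?_⟩
  convert I.sub_mem (I.mul_mem_left y hc) (I.mul_mem_left r hb) using 1; ring

omit [IsLocalRing A] [IsNoetherianRing A] in
lemma mem_of_socle_transfer {I : Ideal A} {y z a b : A} (hy : RegMod I y)
    (hab : y * a - z * b ∈ I) (hb : b ∈ I ⊔ Ideal.span {y}) : a ∈ I ⊔ Ideal.span {z} := by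
  obtain ⟨c, hc⟩ := mem_sup_span.1 hb
  refine mem_sup_span.2 ⟨c, hy _ ?_⟩
  convert I.add_mem hab (I.mul_mem_left z hc) using 1; ring

lemma Reach.exchange {B : Ideal A → Prop}
    (hB : ∀ (I : Ideal A) (y z : A), y ∈ maximalIdeal A → z ∈ maximalIdeal A →
      RegMod I y → RegMod I z → B (I ⊔ Ideal.span {y}) → B (I ⊔ Ideal.span {z}))
    {n : ℕ} {I : Ideal A} (h : Reach B (n + 1) I) {z : A} (hz : z ∈ maximalIdeal A)
    (hr : RegMod I z) : Reach B n (I ⊔ Ideal.span {z}) := by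
  induction n generalizing I z with
  | zero =>
    obtain ⟨y, hy, hyr, hyB⟩ := h
    exact hB I y z hy hz hyr hr hyB
  | succ n ih =>
    obtain ⟨y, hy, hyr, hyB⟩ := h
    have h1 : ∃ w ∈ maximalIdeal A, RegMod (I ⊔ Ideal.span {z}) w := by
      rcases exists_regMod_or_exists_socle (I ⊔ Ideal.span {z}) with h | ⟨a, ha, has⟩
      · exact h
      · exfalso
        obtain ⟨b, hab, hb⟩ := exists_socle_transfer hr has hy
        obtain ⟨w, hw, hwr, -⟩ := hyB
        exact ha (mem_of_socle_transfer hyr hab (hwr b (hb w hw)))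
    obtain ⟨w, hw, hwz, hwy⟩ := exists_regMod_both h1 hyB.depthGE.exists_regMod
    have hwI : RegMod I w := hyr.swap_left hy hwy
    have h2 := ih hyB hw hwy
    have h3 : Reach B (n + 1) (I ⊔ Ideal.span {w}) :=
      ⟨y, hy, hyr.swap_right hwy, by rwa [sup_right_comm] at h2⟩
    have h4 := ih h3 hz (hr.swap_right hwz)
    exact ⟨w, hw, hwz, by rwa [sup_right_comm] at h4⟩

lemma DepthGE.exchange {n : ℕ} {I : Ideal A} (h : DepthGE (n + 1) I) {z : A}
    (hz : z ∈ maximalIdeal A) (hr : RegMod I z) : DepthGE n (I ⊔ Ideal.span {z}) :=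
  Reach.exchange (B := fun _ => True) (fun _ _ _ _ _ _ _ _ => trivial) h hz hr

end Local

section Dimension

variable {A : Type*} [CommRing A]

lemma ringKrullDim_quotient_sup_span (I : Ideal A) (z : A) :
    ringKrullDim (A ⧸ I ⊔ Ideal.span {z}) =
      ringKrullDim ((A ⧸ I) ⧸ Ideal.span {Ideal.Quotient.mk I z}) := by
  have h := ringKrullDim_eq_of_ringEquiv (DoubleQuot.quotQuotEquivQuotSup I (Ideal.span {z}))
  rw [Ideal.map_span, Set.image_singleton] at h
  exact h.symm

lemma RegMod.ringKrullDim_add_one_le {I : Ideal A} {z : A} (h : RegMod I z) :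
    ringKrullDim (A ⧸ I ⊔ Ideal.span {z}) + 1 ≤ ringKrullDim (A ⧸ I) := by
  rw [ringKrullDim_quotient_sup_span]
  apply ringKrullDim_quotient_succ_le_of_nonZeroDivisor
  rw [mem_nonZeroDivisors_iff_right]
  intro y hy
  obtain ⟨a, rfl⟩ := Ideal.Quotient.mk_surjective y
  rw [← map_mul, Ideal.Quotient.eq_zero_iff_mem] at hy
  exact Ideal.Quotient.eq_zero_iff_mem.2 (h a (by rwa [mul_comm]))

lemma ringKrullDim_quotient_anti {I J : Ideal A} (h : I ≤ J) :
    ringKrullDim (A ⧸ J) ≤ ringKrullDim (A ⧸ I) :=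
  ringKrullDim_le_of_surjective (Ideal.Quotient.factor h) (Ideal.Quotient.factor_surjective h)

variable [IsLocalRing A]

lemma ringKrullDim_quotient_le_sup_span_add_one [IsNoetherianRing A] (I : Ideal A) {z : A}
    (hz : z ∈ maximalIdeal A) :
    ringKrullDim (A ⧸ I) ≤ ringKrullDim (A ⧸ I ⊔ Ideal.span {z}) + 1 := by
  rw [ringKrullDim_quotient_sup_span]
  have := ringKrullDim_le_ringKrullDim_quotient_add_encard {Ideal.Quotient.mk I z} (by
    rw [Set.singleton_subset_iff]
    rw [SetLike.mem_coe, Ring.jacobson_eq_sInf_isMaximal]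
    refine Submodule.mem_sInf.2 fun P hP => ?_
    have hPm : Ideal.IsMaximal P := hP
    have hP' := Ideal.comap_isMaximal_of_surjective _ (Ideal.Quotient.mk_surjective (I := I))
      (K := P)
    have : z ∈ Ideal.comap (Ideal.Quotient.mk I) P := by
      rwa [IsLocalRing.eq_maximalIdeal hP']
    exact this)
  simpa using this

lemma maximalIdeal_le_radical_iff {I : Ideal A} :
    maximalIdeal A ≤ I.radical ↔ ringKrullDim (A ⧸ I) ≤ 0 := by
  have h0 : ringKrullDim (A ⧸ I) ≤ 0 ↔ Ring.KrullDimLE 0 (A ⧸ I) := by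
    rw [Ring.krullDimLE_iff]; rfl
  rw [h0]
  constructor
  · intro h
    rw [Ring.krullDimLE_zero_iff]
    intro P hP
    have h2 : I ≤ P.comap (Ideal.Quotient.mk I) := fun a ha => by
      rw [Ideal.mem_comap, Ideal.Quotient.eq_zero_iff_mem.2 ha]; exact P.zero_mem
    have h3 : P.comap (Ideal.Quotient.mk I) = maximalIdeal A :=
      le_antisymm (le_maximalIdeal (hP.comap _).ne_top)
        (h.trans ((hP.comap (Ideal.Quotient.mk I)).radical_le_iff.2 h2))
    have h4 : P = (maximalIdeal A).map (Ideal.Quotient.mk I) := by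
      rw [← h3, Ideal.map_comap_of_surjective _ Ideal.Quotient.mk_surjective]
    rcases Ideal.map_eq_top_or_isMaximal_of_surjective _
      (Ideal.Quotient.mk_surjective (I := I)) (maximalIdeal.isMaximal A) with h5 | h5
    · exact absurd (h4.trans h5) hP.ne_top
    · rwa [h4]
  · intro h
    rw [Ideal.radical_eq_sInf]
    refine le_sInf ?_
    rintro P ⟨hIP, hP⟩
    have h1 : (P.map (Ideal.Quotient.mk I)).IsPrime :=
      Ideal.map_isPrime_of_surjective Ideal.Quotient.mk_surjective (by rwa [Ideal.mk_ker])
    have h2 := Ring.krullDimLE_zero_iff.1 h _ h1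
    have h3 := Ideal.comap_isMaximal_of_surjective _ (Ideal.Quotient.mk_surjective (I := I))
      (K := P.map (Ideal.Quotient.mk I))
    rw [Ideal.comap_map_of_surjective _ Ideal.Quotient.mk_surjective,
      ← RingHom.ker_eq_comap_bot, Ideal.mk_ker, sup_eq_left.2 hIP] at h3
    rw [IsLocalRing.eq_maximalIdeal h3]

end Dimension

section Socle

variable {A : Type*} [CommRing A] [IsLocalRing A]

/-- `A ⧸ I` is Artinian with a socle of length at most one. -/
def SocleOne (I : Ideal A) : Prop :=
  maximalIdeal A ≤ I.radical ∧ ∀ a b, (∀ r ∈ maximalIdeal A, r * a ∈ I) →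
    (∀ r ∈ maximalIdeal A, r * b ∈ I) → b ∉ I → ∃ r, a - r * b ∈ I

/-- `A ⧸ I` is Gorenstein of dimension `d`. -/
abbrev Gor (d : ℕ) (I : Ideal A) : Prop := Reach SocleOne d I

variable [IsNoetherianRing A]

lemma exists_socle_mem {I J : Ideal A} (hI : maximalIdeal A ≤ I.radical) {a : A} (haJ : a ∈ J)
    (haI : a ∉ I) : ∃ b ∈ J, b ∉ I ∧ ∀ r ∈ maximalIdeal A, r * b ∈ I := by
  obtain ⟨n, hn⟩ := Ideal.exists_radical_pow_le_of_fg I (IsNoetherian.noetherian _)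
  have hn' : maximalIdeal A ^ n ≤ I := (Ideal.pow_right_mono hI n).trans hn
  have hex : ∃ k, ∀ r ∈ maximalIdeal A ^ k, r * a ∈ I :=
    ⟨n, fun r hr => I.mul_mem_right a (hn' hr)⟩
  classical
  have hk := Nat.find_spec hex
  have hmin := fun k => Nat.find_min hex (m := k)
  set k := Nat.find hex
  cases hk' : k with
  | zero => exact absurd (by simpa using hk 1 (by simp [hk'])) haI
  | succ l =>
    have := hmin l (by omega)
    push Not at this
    obtain ⟨r, hr, hra⟩ := this
    refine ⟨r * a, J.mul_mem_left r haJ, hra, fun s hs => ?_⟩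
    rw [← mul_assoc]
    exact hk _ (by rw [hk', pow_succ']; exact Ideal.mul_mem_mul hs hr)

lemma SocleOne.exchange {I : Ideal A} {y z : A} (hym : y ∈ maximalIdeal A)
    (hy : RegMod I y) (hz : RegMod I z)
    (h : SocleOne (I ⊔ Ideal.span {y})) : SocleOne (I ⊔ Ideal.span {z}) := by
  refine ⟨?_, fun a b ha hb hbI => ?_⟩
  · have h1 := maximalIdeal_le_radical_iff.1 h.1
    have h2 := ringKrullDim_quotient_le_sup_span_add_one I hym
    have h3 := hz.ringKrullDim_add_one_le
    rw [maximalIdeal_le_radical_iff]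
    have h4 : ringKrullDim (A ⧸ I ⊔ Ideal.span {z}) + 1 ≤ 0 + 1 :=
      h3.trans (h2.trans (by gcongr))
    exact ENat.WithBot.add_le_add_one_right_iff.1 h4
  · obtain ⟨a', haa, ha'⟩ := exists_socle_transfer hz ha hym
    obtain ⟨b', hbb, hb'⟩ := exists_socle_transfer hz hb hym
    obtain ⟨r, hr⟩ := h.2 a' b' ha' hb' fun hmem => hbI (mem_of_socle_transfer hy hbb hmem)
    refine ⟨r, mem_of_socle_transfer hy (b := a' - r * b') ?_ hr⟩
    convert I.sub_mem haa (I.mul_mem_left r hbb) using 1; ring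

lemma Gor.exchange {n : ℕ} {I : Ideal A} (h : Gor (n + 1) I) {z : A}
    (hz : z ∈ maximalIdeal A) (hr : RegMod I z) : Gor n (I ⊔ Ideal.span {z}) :=
  Reach.exchange (B := SocleOne)
    (fun _ _ _ hy _ hyr hzr h => SocleOne.exchange hy hyr hzr h) h hz hr

omit [IsNoetherianRing A] in
lemma SocleOne.of_infIrred {I : Ideal A} (hI : InfIrred I) (hr : maximalIdeal A ≤ I.radical) :
    SocleOne I := by
  refine ⟨hr, fun a b ha hb hbI => ?_⟩
  by_cases haI : a ∈ I
  · exact ⟨0, by simpa using haI⟩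
  by_contra hcon
  push Not at hcon
  have key : (I ⊔ Ideal.span {a}) ⊓ (I ⊔ Ideal.span {b}) = I := by
    refine le_antisymm ?_ (le_inf le_sup_left le_sup_left)
    rintro c ⟨hca, hcb⟩
    obtain ⟨r, hr⟩ := mem_sup_span.1 hca
    obtain ⟨s, hs⟩ := mem_sup_span.1 hcb
    by_cases hrm : r ∈ maximalIdeal A
    · have := I.add_mem hr (ha r hrm)
      convert this using 1; ring
    · obtain ⟨u, rfl⟩ := (IsLocalRing.notMem_maximalIdeal.1 hrm)
      exfalso
      apply hcon (↑u⁻¹ * s)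
      have h1 := I.mul_mem_left (↑u⁻¹ : A) (I.sub_mem hs hr)
      convert h1 using 1
      have : (↑u⁻¹ : A) * u = 1 := u.inv_mul
      linear_combination (-a) * this
  rcases hI.2 key with h | h
  · exact haI (h ▸ Ideal.mem_sup_right (Ideal.mem_span_singleton_self a))
  · exact hbI (h ▸ Ideal.mem_sup_right (Ideal.mem_span_singleton_self b))

omit [IsLocalRing A] [IsNoetherianRing A] in
lemma le_colon_colon (I J : Ideal A) : J ≤ I.colon (I.colon (J : Set A) : Set A) := by
  intro a ha
  rw [mem_ideal_colon]
  intro b hb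
  rw [mul_comm]
  exact mem_ideal_colon.1 hb a ha

/-- Ideals containing `I` satisfy the double annihilator property. -/
lemma SocleOne.colon_colon {I J : Ideal A} (hI : SocleOne I) (hIJ : I ≤ J) :
    I.colon (I.colon (J : Set A) : Set A) = J := by
  obtain ⟨K, hK⟩ := exists_maximal_of_wellFoundedGT
    (fun K : Ideal A => I ≤ K ∧ K ≤ J ∧ I.colon (I.colon (K : Set A) : Set A) = K)
    ⟨I, le_rfl, hIJ, by
      ext a
      rw [mem_ideal_colon]
      constructor
      · intro h
        simpa using h 1 (mem_ideal_colon.2 fun j hj => by simpa using hj)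
      · exact fun h j _ => I.mul_mem_right j h⟩
  obtain ⟨hIK, hKJ, hKK⟩ := hK.prop
  rcases hKJ.eq_or_lt with rfl | hlt
  · exact hKK
  exfalso
  obtain ⟨a₀, ha₀J, ha₀K⟩ := SetLike.exists_of_lt hlt
  obtain ⟨a, haJ, haK, ha⟩ :=
    exists_socle_mem (hI.1.trans (Ideal.radical_mono hIK)) ha₀J ha₀K
  set L := K ⊔ Ideal.span {a} with hL
  have hKL : K ≤ L := le_sup_left
  have haL : a ∈ L := Ideal.mem_sup_right (Ideal.mem_span_singleton_self a)
  suffices h : I.colon (I.colon (L : Set A) : Set A) = L by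
    have := hK.le_of_ge ⟨hIK.trans hKL, sup_le hKJ
      ((Ideal.span_singleton_le_iff_mem _).2 haJ), h⟩ hKL
    exact haK (this haL)
  refine le_antisymm ?_ (le_colon_colon I L)
  have hann : ∀ c ∈ I.colon (K : Set A), c * a ∈ I → c ∈ I.colon (L : Set A) := by
    intro c hc hca
    rw [mem_ideal_colon] at hc ⊢
    intro l hl
    obtain ⟨b, hb⟩ := mem_sup_span.1 hl
    convert I.add_mem (hc _ hb) (I.mul_mem_right b hca) using 1; ring
  have hsoc : ∀ c ∈ I.colon (K : Set A), ∀ r ∈ maximalIdeal A, r * (c * a) ∈ I := by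
    intro c hc r hr
    convert mem_ideal_colon.1 hc _ (ha r hr) using 1; ring
  obtain ⟨c₀, hc₀, hc₀a⟩ : ∃ c ∈ I.colon (K : Set A), c * a ∉ I := by
    by_contra hcon
    push Not at hcon
    have hmem : a ∈ I.colon (I.colon (K : Set A) : Set A) :=
      mem_ideal_colon.2 fun c hc => by rw [mul_comm]; exact hcon c hc
    exact haK (hKK ▸ hmem)
  intro b hb
  rw [mem_ideal_colon] at hb
  have hbc : ∀ r ∈ maximalIdeal A, r * (b * c₀) ∈ I := by
    intro r hr
    convert hb (r * c₀) (hann _ (Ideal.mul_mem_left _ r hc₀) (by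
      rw [mul_assoc]; exact hsoc c₀ hc₀ r hr)) using 1
    ring
  obtain ⟨r, hr⟩ := hI.2 (b * c₀) (c₀ * a) hbc (hsoc c₀ hc₀) hc₀a
  have hmem : b - r * a ∈ I.colon (I.colon (K : Set A) : Set A) := by
    refine mem_ideal_colon.2 fun c hc => ?_
    obtain ⟨s, hs⟩ := hI.2 (c * a) (c₀ * a) (hsoc c hc) (hsoc c₀ hc₀) hc₀a
    have h1 : c - s * c₀ ∈ I.colon (L : Set A) := by
      refine hann _ (Ideal.sub_mem _ hc (Ideal.mul_mem_left _ s hc₀)) ?_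
      convert hs using 1; ring
    have h2 := hb _ h1
    have h3 := mem_ideal_colon.1 h1 a haL
    convert I.add_mem (I.sub_mem h2 (I.mul_mem_left r h3)) (I.mul_mem_left s hr) using 1
    ring
  rw [hKK] at hmem
  exact mem_sup_span.2 ⟨r, by convert hmem using 1; ring⟩

end Socle

section Extension

variable {A : Type*} [CommRing A]

/-- Every homomorphism `J → A ⧸ I` killing `I` (encoded by a function on `A`) is a
multiplication map. -/
def MulExt (I J : Ideal A) : Prop :=
  ∀ φ : A → A, (∀ i ∈ J, ∀ j ∈ J, φ (i + j) - (φ i + φ j) ∈ I) →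
    (∀ r, ∀ i ∈ J, φ (r * i) - r * φ i ∈ I) → (∀ i ∈ J, i ∈ I → φ i ∈ I) →
    ∃ c, ∀ i ∈ J, φ i - c * i ∈ I

/-- Colon ideals commute with reduction modulo a regular element. -/
lemma MulExt.colon_sup_span {I J : Ideal A} (h : MulExt I J) {z : A} (hz : RegMod I z) :
    (I ⊔ Ideal.span {z}).colon (J ⊔ Ideal.span {z} : Ideal A) =
      I.colon (J : Set A) ⊔ Ideal.span {z} := by
  classical
  ext c
  rw [mem_ideal_colon]
  constructor
  · intro hc
    have hex : ∀ i : A, ∃ y, i ∈ J → c * i - z * y ∈ I := by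
      intro i
      by_cases hi : i ∈ J
      · obtain ⟨b, hb⟩ := mem_sup_span.1 (hc i (Ideal.mem_sup_left hi))
        exact ⟨b, fun _ => hb⟩
      · exact ⟨0, fun h => absurd h hi⟩
    choose φ hφ using hex
    obtain ⟨e, he⟩ := h φ
      (fun i hi j hj => hz _ (by
        convert I.sub_mem (I.add_mem (hφ i hi) (hφ j hj)) (hφ _ (J.add_mem hi hj)) using 1
        ring))
      (fun r i hi => hz _ (by
        convert I.sub_mem (I.mul_mem_left r (hφ i hi)) (hφ _ (J.mul_mem_left r hi)) using 1
        ring))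
      (fun i hi hiI => hz _ (by
        convert I.sub_mem (I.mul_mem_left c hiI) (hφ i hi) using 1
        ring))
    refine mem_sup_span.2 ⟨e, mem_ideal_colon.2 fun i hi => ?_⟩
    convert I.add_mem (hφ i hi) (I.mul_mem_left z (he i hi)) using 1
    ring
  · intro hc j hj
    obtain ⟨b, hb⟩ := mem_sup_span.1 hc
    obtain ⟨d, hd⟩ := mem_sup_span.1 hj
    refine mem_sup_span.2 ⟨b * j + (c - z * b) * d, ?_⟩
    convert mem_ideal_colon.1 hb _ hd using 1
    ring

variable [IsLocalRing A] [IsNoetherianRing A]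

lemma SocleOne.mulExt {I : Ideal A} (hI : SocleOne I) (J : Ideal A) : MulExt I J := by
  intro φ hadd hsmul hvan
  have key : ∀ S : Finset A, (S : Set A) ⊆ J → ∃ c, ∀ i ∈ Ideal.span (S : Set A),
      φ i - c * i ∈ I := by
    classical
    intro S
    induction S using Finset.induction_on with
    | empty =>
      intro _
      refine ⟨0, fun i hi => ?_⟩
      have : i = 0 := by simpa using hi
      subst this
      simpa using hvan 0 J.zero_mem I.zero_mem
    | insert a S _ ih =>
      intro hS
      have hSJ : (S : Set A) ⊆ J := fun s hs => hS (by simp [Finset.mem_coe.1 hs])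
      have haJ : a ∈ J := hS (by simp)
      obtain ⟨c, hc⟩ := ih hSJ
      set K := Ideal.span (S : Set A) with hK
      have hKJ : K ≤ J := Ideal.span_le.2 hSJ
      have h1 : φ a - c * a ∈
          I.colon (I.colon ((I.colon ((I ⊔ K : Ideal A) : Set A)) * Ideal.span {a} ⊔ I : Ideal A)) := by
        rw [mem_ideal_colon]
        intro r hr
        rw [mem_ideal_colon] at hr
        have hra : r * a ∈ I ⊔ K := by
          rw [← hI.colon_colon (le_sup_left : I ≤ I ⊔ K), mem_ideal_colon]
          intro s hs
          convert hr (s * a) (Ideal.mem_sup_left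
            (Ideal.mul_mem_mul hs (Ideal.mem_span_singleton_self a))) using 1
          ring
        obtain ⟨b, hb, k, hk, hbk⟩ := Submodule.mem_sup.1 hra
        have hbJ : b ∈ J := by
          rw [eq_sub_of_add_eq hbk]
          exact J.sub_mem (J.mul_mem_left r haJ) (hKJ hk)
        have e1 := hsmul r a haJ
        have e2 := hadd b hbJ k (hKJ hk)
        rw [hbk] at e2
        have e3 := hvan b hbJ hb
        have e4 := hc k hk
        have e5 : c * b ∈ I := I.mul_mem_left c hb
        convert I.sub_mem (I.add_mem (I.add_mem (I.sub_mem e2 e1) e3) e4) e5 using 1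
        linear_combination c * hbk
      rw [hI.colon_colon le_sup_right] at h1
      obtain ⟨p, hp, q, hq, hpq⟩ := Submodule.mem_sup.1 h1
      obtain ⟨c', hc', rfl⟩ := Ideal.mem_mul_span_singleton.1 hp
      refine ⟨c + c', fun i hi => ?_⟩
      rw [Finset.coe_insert, Set.insert_eq, Ideal.span_union, sup_comm] at hi
      obtain ⟨b, hb⟩ := mem_sup_span.1 hi
      have e1 := hadd _ (hKJ hb) _ (J.mul_mem_right b haJ)
      rw [sub_add_cancel, mul_comm a b] at e1
      have e2 := hsmul b a haJ
      have e3 := hc _ hb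
      have e4 := mem_ideal_colon.1 hc' _ (Ideal.mem_sup_right hb)
      have e5 := I.mul_mem_left b hq
      rw [mul_comm a b] at e3 e4
      convert I.sub_mem (I.add_mem (I.add_mem (I.add_mem e1 e2) e3) e5) e4 using 1
      linear_combination (-b) * hpq
  obtain ⟨S, hS⟩ := IsNoetherian.noetherian J
  obtain ⟨c, hc⟩ := key S (by rw [← hS]; exact Ideal.subset_span)
  exact ⟨c, fun i hi => hc i (by
    have : Ideal.span (S : Set A) = J := hS
    rwa [this])⟩

lemma MulExt.of_sup_span {I J : Ideal A} (hIJ : I ≤ J) {z : A} (hzm : z ∈ maximalIdeal A)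
    (hz : RegMod I z) (hzJ : RegMod J z)
    (h : MulExt (I ⊔ Ideal.span {z}) (J ⊔ Ideal.span {z})) : MulExt I J := by
  classical
  set N : Submodule A (J →ₗ[A] A ⧸ I) :=
    { carrier := {f | ∀ i : J, (i : A) ∈ I → f i = 0}
      add_mem' := fun hf hg i hi => by simp [hf i hi, hg i hi]
      zero_mem' := fun i _ => rfl
      smul_mem' := fun c f hf i hi => by simp [hf i hi] } with hN
  set ι : J →ₗ[A] A ⧸ I := (Algebra.linearMap A (A ⧸ I)).comp J.subtype with hι
  have hmain : N ≤ Submodule.span A {ι} := by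
    refine Submodule.le_of_le_smul_of_le_jacobson_bot (I := maximalIdeal A)
      (IsNoetherian.noetherian N) (IsLocalRing.maximalIdeal_le_jacobson _) fun f hf => ?_
    choose ψ hψ using fun i : J => Ideal.Quotient.mk_surjective (f i)
    have hψz : ∀ i : J, ∀ e, (i : A) - z * e ∈ I → ψ i ∈ I ⊔ Ideal.span {z} := by
      intro i e he
      have heJ : e ∈ J := hzJ e (by
        have := J.sub_mem i.2 (hIJ he)
        convert this using 1; ring)
      have h1 : f (i - z • ⟨e, heJ⟩) = 0 := hf _ (by simpa using he)
      rw [map_sub, map_smul, ← hψ, ← hψ, sub_eq_zero] at h1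
      have h2 : Ideal.Quotient.mk I (ψ i) = Ideal.Quotient.mk I (z * ψ ⟨e, heJ⟩) := h1
      exact mem_sup_span.2 ⟨_, Ideal.Quotient.eq.1 h2⟩
    have hψlin : ∀ i j k : J, ∀ r s : A, (i : A) - r * j - s * k ∈ Ideal.span {z} →
        ψ i - r * ψ j - s * ψ k ∈ I ⊔ Ideal.span {z} := by
      intro i j k r s hijk
      obtain ⟨e, he⟩ := Ideal.mem_span_singleton'.1 hijk
      have h1 := hψz (i - r • j - s • k) e (by
        have : ((i - r • j - s • k : J) : A) - z * e = 0 := by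
          simp only [AddSubgroupClass.coe_sub, SetLike.val_smul, smul_eq_mul]
          rw [← he]; ring
        rw [this]; exact I.zero_mem)
      have h2 : ψ (i - r • j - s • k) - (ψ i - r * ψ j - s * ψ k) ∈ I := by
        rw [← Ideal.Quotient.eq, hψ, map_sub, map_sub, map_smul, map_smul, map_sub, map_sub,
          map_mul, map_mul, hψ, hψ, hψ]
        rfl
      have := (I ⊔ Ideal.span {z}).sub_mem h1 (Ideal.mem_sup_left h2)
      convert this using 1; ring
    have hrep : ∀ y : A, ∃ i : J, y ∈ J ⊔ Ideal.span {z} → y - i ∈ Ideal.span {z} := by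
      intro y
      by_cases hy : y ∈ J ⊔ Ideal.span {z}
      · obtain ⟨i, hi, w, hw, rfl⟩ := Submodule.mem_sup.1 hy
        exact ⟨⟨i, hi⟩, fun _ => by simpa using hw⟩
      · exact ⟨0, fun h => absurd h hy⟩
    choose ρ hρ using hrep
    obtain ⟨c, hc⟩ := h (fun y => ψ (ρ y))
      (fun i hi j hj => by
        have := hψlin (ρ (i + j)) (ρ i) (ρ j) 1 1 (by
          have h1 := Ideal.sub_mem _ (Ideal.add_mem _ (hρ i hi) (hρ j hj))
            (hρ _ (Ideal.add_mem _ hi hj))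
          convert h1 using 1; ring)
        convert this using 1; ring)
      (fun r i hi => by
        have := hψlin (ρ (r * i)) (ρ i) 0 r 0 (by
          have h1 := Ideal.sub_mem _ (Ideal.mul_mem_left _ r (hρ i hi))
            (hρ _ (Ideal.mul_mem_left _ r hi))
          convert h1 using 1; ring)
        convert this using 1; ring)
      (fun i hi hiI => by
        obtain ⟨b, hb⟩ := mem_sup_span.1 hiI
        obtain ⟨e, he⟩ := Ideal.mem_span_singleton'.1 (hρ i hi)
        refine hψz _ (b - e) ?_
        convert hb using 1
        linear_combination he)
    have hdiv : ∀ i : J, ∃ y, (ψ i - c * i) - z * y ∈ I := by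
      intro i
      have hi : (i : A) ∈ J ⊔ Ideal.span {z} := Ideal.mem_sup_left i.2
      have h1 := hψlin i (ρ i) 0 1 0 (by simpa using hρ i hi)
      have h2 := hc i hi
      refine mem_sup_span.1 ?_
      convert Ideal.add_mem _ h1 h2 using 1; ring
    choose y hy using hdiv
    have hmk : ∀ i : J, f i - Ideal.Quotient.mk I (c * i) = Ideal.Quotient.mk I (z * y i) := by
      intro i
      rw [← hψ, ← map_sub]
      exact Ideal.Quotient.eq.2 (hy i)
    have hzinj : ∀ a b, Ideal.Quotient.mk I (z * a) = Ideal.Quotient.mk I (z * b) →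
        Ideal.Quotient.mk I a = Ideal.Quotient.mk I b := by
      intro a b hab
      rw [Ideal.Quotient.eq] at hab ⊢
      exact hz _ (by rwa [mul_sub])
    set g : J →ₗ[A] A ⧸ I :=
      { toFun := fun i => Ideal.Quotient.mk I (y i)
        map_add' := fun i j => by
          rw [← map_add]
          apply hzinj
          rw [← hmk, mul_add, map_add (Ideal.Quotient.mk I), ← hmk, ← hmk, map_add f,
            Submodule.coe_add, mul_add, map_add (Ideal.Quotient.mk I)]
          ring
        map_smul' := fun r i => by
          have h1 : (RingHom.id A) r • Ideal.Quotient.mk I (y i)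
            = Ideal.Quotient.mk I (r * y i) := rfl
          rw [h1]
          apply hzinj
          have h2 : r • f i = Ideal.Quotient.mk I r * f i := rfl
          rw [← hmk, mul_left_comm, map_mul (Ideal.Quotient.mk I) r, ← hmk, map_smul f, h2,
            Submodule.coe_smul, smul_eq_mul, mul_left_comm, map_mul (Ideal.Quotient.mk I) r]
          ring } with hg
    have hfg : f = c • ι + z • g := by
      ext i
      have h1 : (c • ι + z • g) i
        = Ideal.Quotient.mk I (c * i) + Ideal.Quotient.mk I (z * y i) := rfl
      rw [h1, ← hmk]; ring
    rw [hfg]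
    refine Submodule.add_mem_sup (Submodule.smul_mem _ _ (Submodule.mem_span_singleton_self ι))
      (Submodule.smul_mem_smul hzm fun i hi => ?_)
    have h0 := hmk i
    rw [hf i hi, Ideal.Quotient.eq_zero_iff_mem.2 (I.mul_mem_left c hi), sub_zero] at h0
    have := hzinj (y i) 0 (by rw [← h0]; simp)
    exact this.trans (map_zero _)
  intro φ hadd hsmul hvan
  set f : J →ₗ[A] A ⧸ I :=
    { toFun := fun i => Ideal.Quotient.mk I (φ i)
      map_add' := fun i j => by
        rw [← map_add]
        exact Ideal.Quotient.eq.2 (hadd i i.2 j j.2)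
      map_smul' := fun r i => Ideal.Quotient.eq.2 (hsmul r i i.2) } with hf
  have hfN : f ∈ N := fun i hi => Ideal.Quotient.eq_zero_iff_mem.2 (hvan i i.2 hi)
  obtain ⟨c, hc⟩ := Submodule.mem_span_singleton.1 (hmain hfN)
  refine ⟨c, fun i hi => ?_⟩
  have h1 : (c • ι) ⟨i, hi⟩ = f ⟨i, hi⟩ := by rw [hc]
  exact Ideal.Quotient.eq.1 h1.symm

/-- A common chain of `d` regular elements modulo `I` and `J`, at the end of which `I` becomes
Gorenstein of dimension zero. -/
def GorPair : ℕ → Ideal A → Ideal A → Prop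
  | 0, I, _ => SocleOne I
  | d + 1, I, J => ∃ z ∈ maximalIdeal A, RegMod I z ∧ RegMod J z ∧
      GorPair d (I ⊔ Ideal.span {z}) (J ⊔ Ideal.span {z})

lemma Gor.gorPair {d : ℕ} {I J : Ideal A} (hI : Gor d I) (hJ : DepthGE d J) :
    GorPair d I J := by
  induction d generalizing I J with
  | zero => exact hI
  | succ d ih =>
    obtain ⟨z, hz, hzI, hzJ⟩ := exists_regMod_both hI.depthGE.exists_regMod hJ.exists_regMod
    exact ⟨z, hz, hzI, hzJ, ih (hI.exchange hz hzI) (hJ.exchange hz hzJ)⟩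

omit [IsNoetherianRing A] in
lemma GorPair.depthGE {d : ℕ} {I J : Ideal A} (h : GorPair d I J) : DepthGE d J := by
  induction d generalizing I J with
  | zero => trivial
  | succ d ih =>
    obtain ⟨z, hz, _, hzJ, h⟩ := h
    exact ⟨z, hz, hzJ, ih h⟩

lemma GorPair.mulExt {d : ℕ} {I J : Ideal A} (h : GorPair d I J) (hIJ : I ≤ J) : MulExt I J := by
  induction d generalizing I J with
  | zero => exact SocleOne.mulExt h J
  | succ d ih =>
    obtain ⟨z, hz, hzI, hzJ, h⟩ := h
    exact MulExt.of_sup_span hIJ hz hzI hzJ (ih h (sup_le_sup_right hIJ _))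

lemma GorPair.colon {d : ℕ} {I J : Ideal A} (h : GorPair d I J) (hIJ : I ≤ J) :
    GorPair d I (I.colon (J : Set A)) := by
  induction d generalizing I J with
  | zero => exact h
  | succ d ih =>
    have hext := h.mulExt hIJ
    obtain ⟨z, hz, hzI, hzJ, h⟩ := h
    refine ⟨z, hz, hzI, hzI.colon _, ?_⟩
    rw [← hext.colon_sup_span hzI]
    exact ih h (sup_le_sup_right hIJ _)

omit [IsLocalRing A] [IsNoetherianRing A] in
lemma colon_sup_span_eq {I J : Ideal A} {z : A} :
    (I ⊔ Ideal.span {z}).colon (J ⊔ Ideal.span {z} : Ideal A) =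
      (I ⊔ Ideal.span {z}).colon (J : Set A) := by
  refine le_antisymm (Submodule.colon_mono le_rfl fun j hj => Ideal.mem_sup_left hj) ?_
  intro a ha
  rw [mem_ideal_colon] at ha ⊢
  intro j hj
  obtain ⟨b, hb⟩ := mem_sup_span.1 hj
  have h1 := ha _ hb
  have h2 : z ∈ I ⊔ Ideal.span {z} := Ideal.mem_sup_right (Ideal.mem_span_singleton_self z)
  convert Ideal.add_mem _ h1 (Ideal.mul_mem_right (a * b) _ h2) using 1; ring

lemma GorPair.colon_colon {d : ℕ} {I J : Ideal A} (h : GorPair d I J) (hIJ : I ≤ J) :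
    I.colon (I.colon (J : Set A) : Set A) = J := by
  induction d generalizing I J with
  | zero => exact SocleOne.colon_colon h hIJ
  | succ d ih =>
    have hext := h.mulExt hIJ
    obtain ⟨z, hz, hzI, hzJ, h⟩ := h
    refine le_antisymm (le_of_forall_exists_sub_mem hz fun a ha => ?_) (le_colon_colon I J)
    have h1 : a ∈ J ⊔ Ideal.span {z} := by
      rw [← ih h (sup_le_sup_right hIJ _), hext.colon_sup_span hzI, colon_sup_span_eq]
      exact Submodule.colon_mono le_sup_left subset_rfl ha
    obtain ⟨b, hb⟩ := mem_sup_span.1 h1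
    refine ⟨b, hzI.colon _ b ?_, hb⟩
    convert Ideal.sub_mem _ ha (le_colon_colon I J hb) using 1; ring

end Extension

section RegularLists

variable {A : Type*} [CommRing A] [IsLocalRing A]

/-- The list `l` is a regular sequence in the maximal ideal modulo the ideal `I`. -/
def RegList : Ideal A → List A → Prop
  | _, [] => True
  | I, z :: l => z ∈ maximalIdeal A ∧ RegMod I z ∧ RegList (I ⊔ Ideal.span {z}) l

lemma RegList.append_iff {I : Ideal A} {l l' : List A} :
    RegList I (l ++ l') ↔ RegList I l ∧ RegList (I ⊔ Ideal.ofList l) l' := by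
  induction l generalizing I with
  | nil => simp [RegList]
  | cons z l ih => simp [RegList, ih, and_assoc, Ideal.ofList_cons, sup_assoc]

lemma RegList.singleton_iff {I : Ideal A} {z : A} :
    RegList I [z] ↔ z ∈ maximalIdeal A ∧ RegMod I z := by simp [RegList]

lemma RegList.mem_maximalIdeal {I : Ideal A} {l : List A} (h : RegList I l) :
    ∀ z ∈ l, z ∈ maximalIdeal A := by
  induction l generalizing I with
  | nil => simp
  | cons z l ih =>
    intro y hy
    rcases List.mem_cons.1 hy with rfl | hy
    · exact h.1
    · exact ih h.2.2 y hy

omit [IsLocalRing A] in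
lemma ofList_le {I : Ideal A} {l : List A} : Ideal.ofList l ≤ I ↔ ∀ z ∈ l, z ∈ I :=
  Ideal.span_le

lemma RegList.ofList_le_maximalIdeal {I : Ideal A} {l : List A} (h : RegList I l) :
    Ideal.ofList l ≤ maximalIdeal A := ofList_le.2 h.mem_maximalIdeal

lemma RegList.depthGE {I : Ideal A} {l : List A} (h : RegList I l) : DepthGE l.length I := by
  induction l generalizing I with
  | nil => trivial
  | cons z l ih => exact ⟨z, h.1, h.2.1, ih h.2.2⟩

omit [IsLocalRing A] in
lemma forall₂_sub_mem_sup_span {I : Ideal A} {l l' : List A}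
    (h : List.Forall₂ (fun a b => a - b ∈ I) l l') : I ⊔ Ideal.ofList l = I ⊔ Ideal.ofList l' := by
  induction h with
  | nil => rfl
  | @cons a b l l' hab _ ih =>
    rw [Ideal.ofList_cons, Ideal.ofList_cons, sup_left_comm, ih, sup_left_comm I, ← sup_assoc,
      ← sup_assoc, sup_comm (Ideal.span {a}), sup_comm (Ideal.span {b})]
    have := sup_span_add (z := b) hab
    rw [add_sub_cancel] at this
    rw [this]

lemma RegList.congr {I : Ideal A} (hI : I ≤ maximalIdeal A) {l l' : List A}
    (h : List.Forall₂ (fun a b => a - b ∈ I) l l') (hl : RegList I l) : RegList I l' := by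
  induction l generalizing I l' with
  | nil => cases h; trivial
  | cons a l ih =>
    rcases h with _ | ⟨hab, hll⟩
    rename_i b l'
    have hb : b = a + (b - a) := by ring
    have hba : b - a ∈ I := by rw [← neg_sub]; exact I.neg_mem hab
    have hbm : b ∈ maximalIdeal A := by rw [hb]; exact Ideal.add_mem _ hl.1 (hI hba)
    have hsup : I ⊔ Ideal.span {b} = I ⊔ Ideal.span {a} := by
      conv_lhs => rw [hb]
      exact sup_span_add hba
    refine ⟨hbm, by rw [hb]; exact hl.2.1.add hba, ?_⟩
    rw [hsup]
    exact ih (sup_le hI ((Ideal.span_singleton_le_iff_mem _).2 hl.1))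
      (hll.imp fun _ _ h => Ideal.mem_sup_left h) hl.2.2

variable [IsNoetherianRing A]

lemma RegList.rotate {I : Ideal A} {y : A} {l : List A} (h : RegList I (y :: l)) :
    RegList I (l ++ [y]) := by
  induction l generalizing I with
  | nil => exact h
  | cons a l ih =>
    obtain ⟨hy, hyI, ha, haI, hl⟩ := h
    refine ⟨ha, hyI.swap_left hy haI, ih ⟨hy, hyI.swap_right haI, ?_⟩⟩
    rwa [sup_right_comm]

lemma RegList.gor_sup {I : Ideal A} {n : ℕ} {l : List A} (h : RegList I l)
    (hI : Gor (n + l.length) I) : Gor n (I ⊔ Ideal.ofList l) := by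
  induction l generalizing I with
  | nil => simpa using hI
  | cons z l ih =>
    rw [Ideal.ofList_cons, ← sup_assoc]
    exact ih h.2.2 (Gor.exchange hI h.1 h.2.1)

/-- The depth of `A ⧸ I` is at most the dimension of `A ⧸ I.colon {s}` for `s ∉ I`. -/
lemma DepthGE.le_ringKrullDim_colon {e : ℕ} {I : Ideal A} (h : DepthGE e I) {s : A} (hs : s ∉ I) :
    (e : WithBot ℕ∞) ≤ ringKrullDim (A ⧸ I.colon {s}) := by
  induction e generalizing I s with
  | zero =>
    have : Nontrivial (A ⧸ I.colon {s}) := by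
      rw [Ideal.Quotient.nontrivial_iff, Ne, Ideal.eq_top_iff_one, mem_ideal_colon_singleton]
      simpa using hs
    exact_mod_cast ringKrullDim_nonneg_of_nontrivial
  | succ e ih =>
    obtain ⟨w, hw, hwI, h⟩ := h
    obtain ⟨K, hK⟩ := exists_maximal_of_wellFoundedGT
      (fun K : Ideal A => ∃ t, I.colon {t} = I.colon {s} ∧ K = I ⊔ Ideal.span {t})
      ⟨_, s, rfl, rfl⟩
    obtain ⟨t, hts, rfl⟩ := hK.prop
    have ht : t ∉ I ⊔ Ideal.span {w} := by
      intro hmem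
      obtain ⟨u, hu⟩ := mem_sup_span.1 hmem
      have hut : I.colon {u} = I.colon {s} := by
        rw [← hts]
        ext a
        rw [mem_ideal_colon_singleton, mem_ideal_colon_singleton]
        constructor
        · intro h
          convert I.add_mem (I.mul_mem_left a hu) (I.mul_mem_left w h) using 1; ring
        · intro h
          apply hwI
          convert I.sub_mem h (I.mul_mem_left a hu) using 1; ring
      have hle : I ⊔ Ideal.span {t} ≤ I ⊔ Ideal.span {u} :=
        sup_le le_sup_left ((Ideal.span_singleton_le_iff_mem _).2
          (mem_sup_span.2 ⟨w, by convert hu using 1; ring⟩))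
      have hmem : u ∈ I ⊔ Ideal.span {t} := hK.le_of_ge ⟨u, hut, rfl⟩ hle
        (Ideal.mem_sup_right (Ideal.mem_span_singleton_self u))
      obtain ⟨r, hr⟩ := mem_sup_span.1 hmem
      have hunit : IsUnit (1 - w * r) := by
        by_contra hcon
        have h1 : 1 - w * r ∈ maximalIdeal A := hcon
        have := Ideal.add_mem _ h1 (Ideal.mul_mem_right r _ hw)
        rw [sub_add_cancel] at this
        exact (Ideal.ne_top_iff_one _).1 (maximalIdeal.isMaximal A).ne_top this
      have huI : u ∈ I := by
        have : (1 - w * r) * u ∈ I := by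
          convert I.add_mem hr (I.mul_mem_left r hu) using 1; ring
        exact (I.unit_mul_mem_iff_mem hunit).1 this
      apply hs
      have h1 : (1 : A) ∈ I.colon {s} := by
        rw [← hut, mem_ideal_colon_singleton]; simpa using huI
      simpa [mem_ideal_colon_singleton] using h1
    have h1 := ih h ht
    have h2 : I.colon {t} ⊔ Ideal.span {w} ≤ (I ⊔ Ideal.span {w}).colon {t} :=
      sup_le (Submodule.colon_mono le_sup_left subset_rfl)
        ((Ideal.span_singleton_le_iff_mem _).2 (mem_ideal_colon_singleton.2
          (Ideal.mem_sup_right (Ideal.mul_mem_right _ _ (Ideal.mem_span_singleton_self w)))))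
    have h3 := (hwI.colon {t}).ringKrullDim_add_one_le
    rw [← hts]
    push_cast
    calc (e : WithBot ℕ∞) + 1 ≤ ringKrullDim (A ⧸ I.colon {t} ⊔ Ideal.span {w}) + 1 := by
          gcongr; exact h1.trans (ringKrullDim_quotient_anti h2)
      _ ≤ _ := h3

lemma DepthGE.le_ringKrullDim {e : ℕ} {I : Ideal A} (h : DepthGE e I) (hI : I ≠ ⊤) :
    (e : WithBot ℕ∞) ≤ ringKrullDim (A ⧸ I) := by
  have := h.le_ringKrullDim_colon (s := 1) ((Ideal.ne_top_iff_one I).1 hI)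
  exact this.trans (ringKrullDim_quotient_anti fun a ha =>
    mem_ideal_colon_singleton.2 (I.mul_mem_right 1 ha))

end RegularLists

section Transfer

variable {S R : Type*} [CommRing S] [CommRing R] {φ : S →+* R}

lemma comap_sup_span (hφ : Function.Surjective φ) (J : Ideal R) (z : S) :
    (J ⊔ Ideal.span {φ z}).comap φ = J.comap φ ⊔ Ideal.span {z} := by
  ext a
  rw [Ideal.mem_comap, mem_sup_span, mem_sup_span, hφ.exists]
  simp

lemma comap_sup_ofList (hφ : Function.Surjective φ) (J : Ideal R) (l : List S) :
    (J ⊔ Ideal.ofList (l.map φ)).comap φ = J.comap φ ⊔ Ideal.ofList l := by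
  induction l generalizing J with
  | nil => simp
  | cons z l ih =>
    rw [List.map_cons, Ideal.ofList_cons, Ideal.ofList_cons, ← sup_assoc, ih,
      comap_sup_span hφ, sup_assoc]

lemma comap_colon (hφ : Function.Surjective φ) (J K : Ideal R) :
    (J.colon (K : Set R)).comap φ = (J.comap φ).colon (K.comap φ : Set S) := by
  ext a
  rw [Ideal.mem_comap, mem_ideal_colon, mem_ideal_colon, hφ.forall]
  simp

lemma RegMod.comap (hφ : Function.Surjective φ) {J : Ideal R} {z : S} :
    RegMod (J.comap φ) z ↔ RegMod J (φ z) := by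
  unfold RegMod
  rw [hφ.forall]
  simp

variable [IsLocalRing S] [IsLocalRing R]

lemma comap_maximalIdeal (hφ : Function.Surjective φ) :
    (maximalIdeal R).comap φ = maximalIdeal S :=
  have := Ideal.comap_isMaximal_of_surjective φ hφ (K := maximalIdeal R)
  IsLocalRing.eq_maximalIdeal this

lemma apply_mem_maximalIdeal_iff (hφ : Function.Surjective φ) {z : S} :
    φ z ∈ maximalIdeal R ↔ z ∈ maximalIdeal S := by
  rw [← comap_maximalIdeal hφ, Ideal.mem_comap]

lemma Reach.comap (hφ : Function.Surjective φ) {B : Ideal R → Prop} {C : Ideal S → Prop}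
    (hBC : ∀ J, B J → C (J.comap φ)) {n : ℕ} {J : Ideal R} (h : Reach B n J) :
    Reach C n (J.comap φ) := by
  induction n generalizing J with
  | zero => exact hBC J h
  | succ n ih =>
    obtain ⟨z, hz, hr, h⟩ := h
    obtain ⟨z, rfl⟩ := hφ z
    refine ⟨z, (apply_mem_maximalIdeal_iff hφ).1 hz, (RegMod.comap hφ).2 hr, ?_⟩
    rw [← comap_sup_span hφ]
    exact ih h

lemma SocleOne.comap (hφ : Function.Surjective φ) {J : Ideal R} (h : SocleOne J) :
    SocleOne (J.comap φ) := by
  refine ⟨?_, fun a b ha hb hbJ => ?_⟩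
  · rw [← Ideal.comap_radical, ← comap_maximalIdeal hφ]
    exact Ideal.comap_mono h.1
  · have key : ∀ c, (∀ r ∈ maximalIdeal S, r * c ∈ J.comap φ) →
        ∀ r ∈ maximalIdeal R, r * φ c ∈ J := by
      intro c hc r hr
      obtain ⟨r, rfl⟩ := hφ r
      rw [← map_mul]
      exact hc r ((apply_mem_maximalIdeal_iff hφ).1 hr)
    obtain ⟨r, hr⟩ := h.2 (φ a) (φ b) (key a ha) (key b hb) hbJ
    obtain ⟨r, rfl⟩ := hφ r
    exact ⟨r, by simpa using hr⟩

lemma RegList.comap (hφ : Function.Surjective φ) {J : Ideal R} {l : List S}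
    (h : RegList J (l.map φ)) : RegList (J.comap φ) l := by
  induction l generalizing J with
  | nil => trivial
  | cons z l ih =>
    refine ⟨(apply_mem_maximalIdeal_iff hφ).1 h.1, (RegMod.comap hφ).2 h.2.1, ?_⟩
    rw [← comap_sup_span hφ]
    exact ih h.2.2

variable [IsNoetherianRing S]

/-- Lifting a link along the reduction modulo a regular element. -/
lemma lift_link (hφ : Function.Surjective φ) {t : S} (htm : t ∈ maximalIdeal S)
    (ht : RegMod ⊥ t) (hker : RingHom.ker φ = Ideal.span {t}) {K : Ideal S} (htK : RegMod K t)
    {p : List S} (hpK : Ideal.ofList p ≤ K) (hp : RegList ⊥ (p.map φ)) {n : ℕ}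
    (hG : Gor n (Ideal.ofList (p.map φ))) (hD : DepthGE n (K.map φ)) :
    RegList ⊥ p ∧ RegMod (Ideal.ofList p) t ∧
      ((Ideal.ofList p).colon (K : Set S)).map φ =
        (Ideal.ofList (p.map φ)).colon (K.map φ : Set R) := by
  have hbot : (⊥ : Ideal R).comap φ = Ideal.span {t} := hker
  have h1 : RegList ⊥ (t :: p) := ⟨htm, ht, by
    rw [bot_sup_eq, ← hbot]; exact hp.comap hφ⟩
  have h2 := RegList.append_iff.1 h1.rotate
  rw [bot_sup_eq, RegList.singleton_iff] at h2
  obtain ⟨hpr, -, htp⟩ := h2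
  have hcp : (Ideal.ofList (p.map φ)).comap φ = Ideal.ofList p ⊔ Ideal.span {t} := by
    have := comap_sup_ofList hφ ⊥ p
    rwa [bot_sup_eq, hbot, sup_comm] at this
  have hcm : ∀ L : Ideal S, (L.map φ).comap φ = L ⊔ Ideal.span {t} := fun L => by
    rw [Ideal.comap_map_of_surjective _ hφ, hbot]
  have hG' : Gor (n + 1) (Ideal.ofList p) := ⟨t, htm, htp, by
    rw [← hcp]; exact Reach.comap hφ (fun J hJ => SocleOne.comap hφ hJ) hG⟩
  have hD' : DepthGE (n + 1) K := ⟨t, htm, htK, by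
    rw [← hcm]; exact Reach.comap hφ (fun _ _ => trivial) hD⟩
  refine ⟨hpr, htp, Ideal.comap_injective_of_surjective φ hφ ?_⟩
  rw [hcm, comap_colon hφ, hcp, hcm, ((hG'.gorPair hD').mulExt hpK).colon_sup_span htp]

end Transfer

section Linkage

variable {A : Type*} [CommRing A] [IsLocalRing A]

/-- Linkage by a regular sequence of length `g`; the unit ideal is allowed. -/
def Linked (g : ℕ) (I J : Ideal A) : Prop :=
  ∃ l : List A, l.length = g ∧ RegList ⊥ l ∧ Ideal.ofList l ≤ I ∧ Ideal.ofList l ≤ J ∧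
    (Ideal.ofList l).colon (I : Set A) = J ∧ (Ideal.ofList l).colon (J : Set A) = I

/-- The equivalence class under linkage by regular sequences of length `g`. -/
abbrev LinkClass (g : ℕ) : Ideal A → Ideal A → Prop := Relation.ReflTransGen (Linked g)

/-- The sum of all ideals in an extended linkage class. -/
def linkSum (g : ℕ) (I : Ideal A) : Ideal A := sSup {J | LinkClass g I J}

lemma Linked.symm {g : ℕ} {I J : Ideal A} : Linked g I J → Linked g J I
  | ⟨l, h1, h2, h3, h4, h5, h6⟩ => ⟨l, h1, h2, h4, h3, h6, h5⟩

lemma LinkClass.symm {g : ℕ} {I J : Ideal A} (h : LinkClass g I J) : LinkClass g J I :=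
  haveI : Std.Symm (Linked (A := A) g) := ⟨fun _ _ h => h.symm⟩
  Relation.ReflTransGen.stdSymm.symm _ _ h

lemma LinkClass.le_linkSum {g : ℕ} {I J : Ideal A} (h : LinkClass g I J) : J ≤ linkSum g I :=
  le_sSup h

variable [IsNoetherianRing A]

lemma Gor.ringKrullDim_le {d : ℕ} {I : Ideal A} (h : Gor d I) :
    ringKrullDim (A ⧸ I) ≤ d := by
  induction d generalizing I with
  | zero => exact_mod_cast maximalIdeal_le_radical_iff.1 h.1
  | succ d ih =>
    obtain ⟨z, hz, -, h⟩ := h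
    refine (ringKrullDim_quotient_le_sup_span_add_one I hz).trans ?_
    push_cast
    gcongr
    exact ih h

variable {g e : ℕ}

lemma RegList.gor_ofList (hA : Gor (e + g) (⊥ : Ideal A)) {l : List A} (hl : RegList ⊥ l)
    (hlg : l.length = g) : Gor e (Ideal.ofList l) := by
  have := hl.gor_sup (n := e) (by rwa [hlg])
  rwa [bot_sup_eq] at this

lemma RegList.gorPair (hA : Gor (e + g) (⊥ : Ideal A)) {l : List A} (hl : RegList ⊥ l)
    (hlg : l.length = g) {I : Ideal A} (hI : DepthGE e I) : GorPair e (Ideal.ofList l) I :=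
  (hl.gor_ofList hA hlg).gorPair hI

lemma RegList.linked (hA : Gor (e + g) (⊥ : Ideal A)) {l : List A} (hl : RegList ⊥ l)
    (hlg : l.length = g) {I : Ideal A} (hI : DepthGE e I) (hlI : Ideal.ofList l ≤ I) :
    Linked g I ((Ideal.ofList l).colon (I : Set A)) :=
  ⟨l, hlg, hl, hlI, Ideal.le_colon, rfl, (hl.gorPair hA hlg hI).colon_colon hlI⟩

lemma Linked.depthGE (hA : Gor (e + g) (⊥ : Ideal A)) {I J : Ideal A} (h : Linked g I J)
    (hI : DepthGE e I) : DepthGE e J := by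
  obtain ⟨l, hlg, hl, hlI, -, rfl, -⟩ := h
  exact ((hl.gorPair hA hlg hI).colon hlI).depthGE

lemma LinkClass.depthGE (hA : Gor (e + g) (⊥ : Ideal A)) {I J : Ideal A} (h : LinkClass g I J)
    (hI : DepthGE e I) : DepthGE e J := by
  induction h with
  | refl => exact hI
  | tail _ h ih => exact h.depthGE hA ih

omit [IsLocalRing A] [IsNoetherianRing A] in
lemma RegMod.unit_mul {I : Ideal A} {y u : A} (h : RegMod I y) (hu : IsUnit u) :
    RegMod I (u * y) := fun a ha =>
  h a ((I.unit_mul_mem_iff_mem hu).1 (by rwa [← mul_assoc]))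

/-- Links descend to hypersurface sections. -/
lemma Linked.sup_span (hA : Gor (e + 1 + g) (⊥ : Ideal A)) {I J : Ideal A} (hI : DepthGE (e + 1) I)
    {l : List A} (hlg : l.length = g) (hl : RegList ⊥ l) (hlI : Ideal.ofList l ≤ I)
    (hIJ : (Ideal.ofList l).colon (I : Set A) = J) {x : A} (hxm : x ∈ maximalIdeal A)
    (hx : RegMod (Ideal.ofList l) x) :
    Linked (g + 1) (I ⊔ Ideal.span {x}) (J ⊔ Ideal.span {x}) := by
  have hJI : (Ideal.ofList l).colon (J : Set A) = I := by
    rw [← hIJ]; exact (hl.gorPair hA hlg hI).colon_colon hlI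
  have hlJ : Ideal.ofList l ≤ J := hIJ ▸ Ideal.le_colon
  have hJ : DepthGE (e + 1) J := Linked.depthGE hA ⟨l, hlg, hl, hlI, hlJ, hIJ, hJI⟩ hI
  have e1 := ((hl.gorPair hA hlg hI).mulExt hlI).colon_sup_span hx
  have e2 := ((hl.gorPair hA hlg hJ).mulExt hlJ).colon_sup_span hx
  have hof : Ideal.ofList (l ++ [x]) = Ideal.ofList l ⊔ Ideal.span {x} := by
    rw [Ideal.ofList_append, Ideal.ofList_singleton]
  refine ⟨l ++ [x], by simp [hlg], RegList.append_iff.2 ⟨hl, ?_⟩, ?_, ?_, ?_, ?_⟩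
  · rw [bot_sup_eq, RegList.singleton_iff]; exact ⟨hxm, hx⟩
  · rw [hof]; exact sup_le_sup_right hlI _
  · rw [hof]; exact sup_le_sup_right hlJ _
  · rw [hof, e1, hIJ]
  · rw [hof, e2, hJI]

lemma Linked.exists_regMod_sup_span (hA : Gor (e + 1 + g) (⊥ : Ideal A)) {I J : Ideal A}
    (h : Linked g I J) (hI : DepthGE (e + 1) I) {x : A} (hxm : x ∈ maximalIdeal A)
    (hx : RegMod I x) : ∃ y ∈ maximalIdeal A, RegMod J y ∧
      Linked (g + 1) (I ⊔ Ideal.span {x}) (J ⊔ Ideal.span {y}) := by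
  obtain ⟨l, hlg, hl, hlI, hlJ, hIJ, hJI⟩ := h
  have hG := hl.gor_ofList hA hlg
  obtain ⟨i, hi, hreg⟩ := exists_add_notMem_primes (associatedPrimes.finite A (A ⧸ Ideal.ofList l))
    (fun P hP => hP.1) (I ⊓ maximalIdeal A) x (by
      intro P hP hxP hle
      obtain ⟨s, hs, rfl⟩ := exists_colon_singleton_of_mem_associatedPrimes hP
      have h1 := hG.depthGE.le_ringKrullDim_colon hs
      by_cases hItop : I = ⊤
      · have h2 := maximalIdeal_le_radical_iff.1
          ((show maximalIdeal A ≤ _ by simpa [hItop] using hle).trans Ideal.le_radical)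
        have h3 := h1.trans h2
        norm_cast at h3
      · rw [inf_eq_left.2 (le_maximalIdeal hItop)] at hle
        have h2 := ringKrullDim_quotient_anti
          (sup_le hle ((Ideal.span_singleton_le_iff_mem _).2 hxP))
        have h3 := hx.ringKrullDim_add_one_le
        have h4 := (ringKrullDim_quotient_anti hlI).trans hG.ringKrullDim_le
        have h5 : ((e + 1 : ℕ) : WithBot ℕ∞) + 1 ≤ (e + 1 : ℕ) :=
          (add_le_add_left (h1.trans h2) 1).trans (h3.trans h4)
        norm_cast at h5
        omega)
  have hym : x + i ∈ maximalIdeal A := Ideal.add_mem _ hxm hi.2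
  have hreg' := regMod_iff_notMem_associatedPrimes.2 hreg
  refine ⟨x + i, hym, hIJ ▸ hreg'.colon _, ?_⟩
  rw [← sup_span_add hi.1]
  exact Linked.sup_span hA hI hlg hl hlI hIJ hym hreg'

lemma linkSum_sup_span_le (hA : Gor (e + 1 + g) (⊥ : Ideal A)) {I : Ideal A}
    (hI : DepthGE (e + 1) I) {x : A} (hxm : x ∈ maximalIdeal A) (hx : RegMod I x) :
    linkSum g I ⊔ Ideal.span {x} ≤ linkSum (g + 1) (I ⊔ Ideal.span {x}) := by
  refine sup_le (sSup_le fun J hJ => ?_) (le_sup_right.trans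
    (LinkClass.le_linkSum Relation.ReflTransGen.refl))
  obtain ⟨y, -, -, hy⟩ : ∃ y ∈ maximalIdeal A, RegMod J y ∧
      LinkClass (g + 1) (I ⊔ Ideal.span {x}) (J ⊔ Ideal.span {y}) := by
    induction hJ with
    | refl => exact ⟨x, hxm, hx, Relation.ReflTransGen.refl⟩
    | tail hJ hJK ih =>
      obtain ⟨y, hym, hy, hcl⟩ := ih
      obtain ⟨w, hwm, hw, hlk⟩ :=
        hJK.exists_regMod_sup_span hA (LinkClass.depthGE hA hJ hI) hym hy
      exact ⟨w, hwm, hw, hcl.tail hlk⟩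
  exact le_sup_left.trans hy.le_linkSum

end Linkage

section Localize

variable {P : Type*} [CommRing P] {q : Ideal P} [q.IsPrime]

lemma mem_map_at {I : Ideal P} {a : P} :
    algebraMap P (Localization.AtPrime q) a ∈ I.map (algebraMap P (Localization.AtPrime q)) ↔
      ∃ s ∉ q, s * a ∈ I :=
  IsLocalization.algebraMap_mem_map_algebraMap_iff q.primeCompl _ I a

lemma exists_unit_mul_eq (q : Ideal P) [q.IsPrime] (b : Localization.AtPrime q) :
    ∃ u a, IsUnit u ∧ u * b = algebraMap P (Localization.AtPrime q) a := by
  obtain ⟨⟨a, s⟩, h⟩ := IsLocalization.surj q.primeCompl b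
  exact ⟨_, a, IsLocalization.map_units _ s, by rw [mul_comm]; exact h⟩

lemma isUnit_at {a : P} :
    IsUnit (algebraMap P (Localization.AtPrime q) a) ↔ a ∉ q :=
  IsLocalization.AtPrime.isUnit_to_map_iff (Localization.AtPrime q) q a

lemma mem_maximalIdeal_at {a : P} :
    algebraMap P (Localization.AtPrime q) a ∈ maximalIdeal (Localization.AtPrime q) ↔ a ∈ q :=
  IsLocalization.AtPrime.to_map_mem_maximal_iff (Localization.AtPrime q) q a

lemma regMod_at {I : Ideal P} {z : P} :
    RegMod (I.map (algebraMap P (Localization.AtPrime q)))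
      (algebraMap P (Localization.AtPrime q) z) ↔ ∀ a, z * a ∈ I → ∃ s ∉ q, s * a ∈ I := by
  constructor
  · intro h a ha
    rw [← mem_map_at]
    refine h _ ?_
    rw [← map_mul]
    exact Ideal.mem_map_of_mem _ ha
  · intro h b hb
    obtain ⟨u, a, hu, e⟩ := exists_unit_mul_eq q b
    rw [← Ideal.unit_mul_mem_iff_mem _ hu, mul_left_comm, e, ← map_mul, mem_map_at] at hb
    obtain ⟨s, hs, hsa⟩ := hb
    rw [← Ideal.unit_mul_mem_iff_mem _ hu, e, mem_map_at]
    obtain ⟨s', hs', h'⟩ := h (s * a) (by rwa [mul_left_comm])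
    exact ⟨s' * s, q.primeCompl.mul_mem hs' hs, by rwa [mul_assoc]⟩

lemma regMod_at_of_forall_mul_mem {I : Ideal P} {z : P} (h : RegMod I z) :
    RegMod (I.map (algebraMap P (Localization.AtPrime q)))
      (algebraMap P (Localization.AtPrime q) z) :=
  regMod_at.2 fun a ha => ⟨1, (Ideal.ne_top_iff_one _).1 Ideal.IsPrime.ne_top', by simpa using h a ha⟩

lemma exists_notMem_forall_mul_mem {ι : Type*} (s : Finset ι) {I : Ideal P} {f : ι → P}
    (h : ∀ i ∈ s, ∃ D ∉ q, D * f i ∈ I) : ∃ D ∉ q, ∀ i ∈ s, D * f i ∈ I := by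
  classical
  induction s using Finset.induction_on with
  | empty => exact ⟨1, (Ideal.ne_top_iff_one _).1 Ideal.IsPrime.ne_top', by simp⟩
  | insert i s _ ih =>
    obtain ⟨D, hD, h1⟩ := ih fun j hj => h j (Finset.mem_insert_of_mem hj)
    obtain ⟨D', hD', h2⟩ := h i (Finset.mem_insert_self _ _)
    refine ⟨D * D', q.primeCompl.mul_mem hD hD', fun j hj => ?_⟩
    rcases Finset.mem_insert.1 hj with rfl | hj
    · rw [mul_assoc]; exact I.mul_mem_left _ h2
    · rw [mul_comm D, mul_assoc]; exact I.mul_mem_left _ (h1 j hj)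

/-- A finitely generated ideal that is locally contained in `I` is so after multiplication by a
single element. -/
lemma exists_notMem_forall_mem {I J : Ideal P} (hJ : J.FG) (h : ∀ a ∈ J, ∃ s ∉ q, s * a ∈ I) :
    ∃ D ∉ q, ∀ a ∈ J, D * a ∈ I := by
  obtain ⟨s, rfl⟩ := hJ
  obtain ⟨D, hD, h1⟩ := exists_notMem_forall_mul_mem (f := id) s
    fun i hi => h i (Ideal.subset_span hi)
  refine ⟨D, hD, fun a ha => ?_⟩
  have : Ideal.span (s : Set P) ≤ I.colon {D} := Ideal.span_le.2 fun i hi => by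
    rw [SetLike.mem_coe, mem_ideal_colon_singleton, mul_comm]
    exact h1 i hi
  have := this ha
  rwa [mem_ideal_colon_singleton, mul_comm] at this

lemma map_colon_at {I J : Ideal P} (hJ : J.FG) :
    (I.colon (J : Set P)).map (algebraMap P (Localization.AtPrime q)) =
      (I.map (algebraMap P (Localization.AtPrime q))).colon
        (J.map (algebraMap P (Localization.AtPrime q)) : Set (Localization.AtPrime q)) := by
  apply le_antisymm
  · rw [Ideal.map_le_iff_le_comap]
    intro a ha
    rw [mem_ideal_colon] at ha
    have h2 : J.map (algebraMap P (Localization.AtPrime q)) ≤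
        (I.map (algebraMap P (Localization.AtPrime q))).colon
          {algebraMap P (Localization.AtPrime q) a} := by
      rw [Ideal.map_le_iff_le_comap]
      intro j hj
      rw [Ideal.mem_comap, mem_ideal_colon_singleton, ← map_mul, mul_comm]
      exact Ideal.mem_map_of_mem _ (ha j hj)
    rw [Ideal.mem_comap, mem_ideal_colon]
    intro j hj
    have := h2 hj
    rwa [mem_ideal_colon_singleton, mul_comm] at this
  · intro b hb
    obtain ⟨u, a, hu, e⟩ := exists_unit_mul_eq q b
    rw [← Ideal.unit_mul_mem_iff_mem _ hu, e] at hb ⊢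
    rw [mem_ideal_colon] at hb
    obtain ⟨D, hD, h⟩ := exists_notMem_forall_mem (I := I.colon {a}) (q := q) hJ (fun j hj => by
      have := hb _ (Ideal.mem_map_of_mem _ hj)
      rw [← map_mul, mem_map_at] at this
      obtain ⟨s, hs, h⟩ := this
      refine ⟨s, hs, ?_⟩
      rwa [mem_ideal_colon_singleton, mul_assoc, mul_comm j])
    refine mem_map_at.2 ⟨D, hD, mem_ideal_colon.2 fun j hj => ?_⟩
    have := h j hj
    rwa [mem_ideal_colon_singleton, mul_assoc, mul_comm j, ← mul_assoc] at this

lemma map_comap_at (I : Ideal (Localization.AtPrime q)) :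
    (I.comap (algebraMap P (Localization.AtPrime q))).map
      (algebraMap P (Localization.AtPrime q)) = I :=
  IsLocalization.map_under q.primeCompl _ I

lemma exists_map_eq_map_of_le [IsNoetherianRing P] (I : Ideal P) :
    ∃ D ∉ q, ∀ a, (∃ s ∉ q, s * a ∈ I) → D * a ∈ I := by
  obtain ⟨D, hD, h⟩ := exists_notMem_forall_mem (q := q) (I := I)
    (J := (I.map (algebraMap P (Localization.AtPrime q))).comap _)
    (IsNoetherian.noetherian _) (fun a ha => mem_map_at.1 ha)
  exact ⟨D, hD, fun a ha => h a (mem_map_at.2 ha)⟩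

/-- Regular sequences in the smaller prime localize. -/
lemma RegList.of_le {q' : Ideal P} [q'.IsPrime] (hq : q ≤ q') {l : List P} (hl : ∀ z ∈ l, z ∈ q)
    {I : Ideal P} (h : RegList (I.map (algebraMap P (Localization.AtPrime q')))
      (l.map (algebraMap P (Localization.AtPrime q')))) :
    RegList (I.map (algebraMap P (Localization.AtPrime q)))
      (l.map (algebraMap P (Localization.AtPrime q))) := by
  induction l generalizing I with
  | nil => trivial
  | cons z l ih =>
    obtain ⟨-, h2, h3⟩ := h
    refine ⟨mem_maximalIdeal_at.2 (hl z (by simp)), regMod_at.2 fun a ha => ?_, ?_⟩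
    · obtain ⟨s, hs, hsa⟩ := regMod_at.1 h2 a ha
      exact ⟨s, fun h => hs (hq h), hsa⟩
    · rw [← Set.image_singleton, ← Ideal.map_span, ← Ideal.map_sup] at h3 ⊢
      exact ih (fun y hy => hl y (by simp [hy])) h3

/-- A regular sequence in a localization is regular in nearby localizations. -/
lemma RegList.exists_of_le [IsNoetherianRing P] {l : List P} {I : Ideal P}
    (h : RegList (I.map (algebraMap P (Localization.AtPrime q)))
      (l.map (algebraMap P (Localization.AtPrime q)))) :
    ∃ D ∉ q, ∀ q' : Ideal P, ∀ _ : q'.IsPrime, q ≤ q' → D ∉ q' →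
      RegList (I.map (algebraMap P (Localization.AtPrime q')))
        (l.map (algebraMap P (Localization.AtPrime q'))) := by
  induction l generalizing I with
  | nil => exact ⟨1, (Ideal.ne_top_iff_one _).1 Ideal.IsPrime.ne_top', fun _ _ _ _ => trivial⟩
  | cons z l ih =>
    obtain ⟨h1, h2, h3⟩ := h
    rw [← Set.image_singleton, ← Ideal.map_span, ← Ideal.map_sup] at h3
    obtain ⟨D, hD, h⟩ := ih h3
    obtain ⟨E, hE, h'⟩ := exists_map_eq_map_of_le (q := q) I
    refine ⟨D * E, q.primeCompl.mul_mem hD hE, fun q' _ hq hDE => ⟨?_, ?_, ?_⟩⟩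
    · exact mem_maximalIdeal_at.2 (hq (mem_maximalIdeal_at.1 h1))
    · exact regMod_at.2 fun a ha => ⟨E, fun hE' => hDE (q'.mul_mem_left _ hE'),
        h' a (regMod_at.1 h2 a ha)⟩
    · rw [← Set.image_singleton, ← Ideal.map_span, ← Ideal.map_sup]
      exact h q' _ hq fun hD' => hDE (q'.mul_mem_right _ hD')

/-- Regular sequences in a localization are, up to units, images of sequences. -/
lemma RegList.exists_map {I : Ideal (Localization.AtPrime q)} {l : List (Localization.AtPrime q)}
    (h : RegList I l) : ∃ p : List P, p.length = l.length ∧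
      RegList I (p.map (algebraMap P (Localization.AtPrime q))) ∧
      Ideal.ofList (p.map (algebraMap P (Localization.AtPrime q))) = Ideal.ofList l := by
  induction l generalizing I with
  | nil => exact ⟨[], rfl, trivial, rfl⟩
  | cons z l ih =>
    obtain ⟨h1, h2, h3⟩ := h
    obtain ⟨p, hp1, hp2, hp3⟩ := ih h3
    obtain ⟨u, a, hu, e⟩ := exists_unit_mul_eq q z
    have hs : Ideal.span {algebraMap P (Localization.AtPrime q) a} = Ideal.span {z} := by
      rw [← e, Ideal.span_singleton_mul_left_unit hu]
    refine ⟨a :: p, by simp [hp1], ⟨?_, ?_, ?_⟩, ?_⟩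
    · rw [← e]; exact Ideal.mul_mem_left _ _ h1
    · rw [← e]; exact h2.unit_mul hu
    · rwa [hs]
    · rw [List.map_cons, Ideal.ofList_cons, Ideal.ofList_cons, hp3, hs]

end Localize

noncomputable section Generic

open Polynomial

variable {A : Type*} [CommRing A] [IsLocalRing A]

variable (A) in
/-- The filter of generic elements: those whose residue avoids a finite set. -/
def generic : Filter A := Filter.comap (residue A) Filter.cofinite

instance [Infinite (ResidueField A)] : (generic A).NeBot :=
  Filter.NeBot.comap_of_surj inferInstance residue_surjective

variable (A) in
/-- The extension of the maximal ideal to the polynomial ring. -/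
abbrev extPrime : Ideal A[X] := (maximalIdeal A).map C

instance : (extPrime A).IsPrime := Ideal.isPrime_map_C_of_isPrime

/-- The maximal ideal of the polynomial ring at the residue of `u`. -/
abbrev evalPrime (u : A) : Ideal A[X] := (maximalIdeal A).comap (evalRingHom u)

instance (u : A) : (evalPrime u).IsPrime := Ideal.comap_isPrime _ _

omit [IsLocalRing A] in
lemma map_eval_map_C (I : Ideal A) (u : A) : (I.map C).map (evalRingHom u) = I := by
  rw [Ideal.map_map]
  convert I.map_id
  ext; simp

omit [IsLocalRing A] in
lemma eval_mem_of_mem_map_C {I : Ideal A} {p : A[X]} (hp : p ∈ I.map C) (u : A) :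
    p.eval u ∈ I := by
  have := Ideal.mem_map_of_mem (evalRingHom u) hp
  rwa [map_eval_map_C] at this

lemma extPrime_le_evalPrime (u : A) : extPrime A ≤ evalPrime u := fun _ hp =>
  eval_mem_of_mem_map_C hp u

lemma X_sub_C_notMem_extPrime (u : A) : X - C u ∉ extPrime A := by
  intro h
  have := eval_mem_of_mem_map_C h (u + 1)
  simp at this

lemma eventually_notMem_evalPrime {D : A[X]} (hD : D ∉ extPrime A) :
    ∀ᶠ u in generic A, D ∉ evalPrime u := by
  have h0 : D.map (residue A) ≠ 0 := by
    intro h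
    refine hD (Ideal.mem_map_C_iff.2 fun n => ?_)
    rw [← residue_eq_zero_iff, ← coeff_map, h, coeff_zero]
  have hfin : ∀ᶠ v in Filter.cofinite, ¬ (D.map (residue A)).IsRoot v := by
    rw [Filter.eventually_cofinite]
    simp only [not_not]
    exact finite_setOfPred_isRoot h0
  refine (hfin.comap (residue A)).mono fun u hu hmem => hu ?_
  rw [IsRoot, eval_map_apply, residue_eq_zero_iff]
  exact hmem

lemma eventually_isUnit_sub (u₀ : A) : ∀ᶠ u in generic A, IsUnit (u - u₀) := by
  filter_upwards [eventually_notMem_evalPrime (X_sub_C_notMem_extPrime u₀)] with u hu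
  simpa [mem_maximalIdeal] using hu

/-- A polynomial with generic values in an ideal has its coefficients in that ideal. -/
lemma mem_map_C_of_eventually [Infinite (ResidueField A)] {I : Ideal A} {p : A[X]}
    (h : ∀ᶠ u in generic A, p.eval u ∈ I) : p ∈ I.map C := by
  induction hn : p.natDegree using Nat.strong_induction_on generalizing p with
  | _ n ih =>
    obtain ⟨u₀, hu₀⟩ := h.exists
    have e := modByMonic_add_div p (X - C u₀)
    rw [modByMonic_X_sub_C_eq_C_eval] at e
    rcases Nat.eq_zero_or_pos n with rfl | hpos
    · rw [eq_C_of_natDegree_eq_zero hn] at hu₀ ⊢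
      rw [eval_C] at hu₀
      exact Ideal.mem_map_of_mem _ hu₀
    rw [← e]
    refine Ideal.add_mem _ (Ideal.mem_map_of_mem _ hu₀) (Ideal.mul_mem_left _ _ (ih _ ?_ ?_ rfl))
    · rw [natDegree_divByMonic _ (monic_X_sub_C u₀), natDegree_X_sub_C]; omega
    · filter_upwards [h, eventually_isUnit_sub u₀] with u hu hun
      rw [← Ideal.unit_mul_mem_iff_mem _ hun]
      have e' := congr_arg (eval u) e
      simp only [eval_add, eval_C, eval_mul, eval_sub, eval_X] at e'
      have : (u - u₀) * eval u (p /ₘ (X - C u₀)) = eval u p - eval u₀ p := by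
        rw [← e', add_sub_cancel_left]
      rw [this]
      exact I.sub_mem hu hu₀

lemma mem_map_C_of_mul_mem [Infinite (ResidueField A)] {I : Ideal A} {s p : A[X]}
    (hs : s ∉ extPrime A) (h : s * p ∈ I.map C) : p ∈ I.map C := by
  refine mem_map_C_of_eventually ?_
  filter_upwards [eventually_notMem_evalPrime hs] with u hu
  have := eval_mem_of_mem_map_C h u
  rw [eval_mul] at this
  refine (Ideal.unit_mul_mem_iff_mem _ ?_).1 this
  simpa [mem_maximalIdeal] using hu

variable (A) in
/-- The localization of the polynomial ring at the extended maximal ideal. -/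
abbrev GenericExt : Type _ := Localization.AtPrime (extPrime A)

/-- The extension of an ideal to the generic extension. -/
abbrev gext (I : Ideal A) : Ideal (GenericExt A) :=
  (I.map C).map (algebraMap A[X] (GenericExt A))

lemma mem_gext [Infinite (ResidueField A)] {I : Ideal A} {p : A[X]} :
    algebraMap A[X] (GenericExt A) p ∈ gext I ↔ p ∈ I.map C := by
  rw [mem_map_at]
  constructor
  · rintro ⟨s, hs, h⟩
    exact mem_map_C_of_mul_mem hs h
  · intro h
    exact ⟨1, (Ideal.ne_top_iff_one _).1 Ideal.IsPrime.ne_top', by simpa using h⟩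

/-- The canonical map to the generic extension. -/
abbrev toExt (a : A) : GenericExt A := algebraMap A[X] (GenericExt A) (C a)

lemma gext_sup_span (I : Ideal A) (z : A) :
    gext (I ⊔ Ideal.span {z}) = gext I ⊔ Ideal.span {toExt z} := by
  simp only [gext, Ideal.map_sup, Ideal.map_span, Set.image_singleton]

lemma toExt_mem_maximalIdeal {z : A} (hz : z ∈ maximalIdeal A) :
    toExt z ∈ maximalIdeal (GenericExt A) :=
  mem_maximalIdeal_at.2 (Ideal.mem_map_of_mem _ hz)

lemma gext_le_maximalIdeal {I : Ideal A} (hI : I ≤ maximalIdeal A) :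
    gext I ≤ maximalIdeal (GenericExt A) := by
  rw [gext, Ideal.map_le_iff_le_comap]
  exact fun p hp => mem_maximalIdeal_at.2 (Ideal.map_mono hI hp)

lemma maximalIdeal_genericExt : maximalIdeal (GenericExt A) = gext (maximalIdeal A) :=
  (Localization.AtPrime.map_eq_maximalIdeal).symm

lemma RegMod.gext {I : Ideal A} {z : A} (h : RegMod I z) : RegMod (gext I) (toExt z) :=
  regMod_at_of_forall_mul_mem fun a ha => Ideal.mem_map_C_iff.2 fun n => h _ (by
    rw [← coeff_C_mul]; exact Ideal.mem_map_C_iff.1 ha n)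

lemma Reach.gext {B : Ideal A → Prop} {B' : Ideal (GenericExt A) → Prop}
    (hB : ∀ J, B J → B' (gext J)) {n : ℕ} {I : Ideal A} (h : Reach B n I) :
    Reach B' n (gext I) := by
  induction n generalizing I with
  | zero => exact hB I h
  | succ n ih =>
    obtain ⟨z, hz, hr, h⟩ := h
    refine ⟨toExt z, toExt_mem_maximalIdeal hz, hr.gext, ?_⟩
    rw [← gext_sup_span]
    exact ih h

lemma SocleOne.gext [IsNoetherianRing A] [Infinite (ResidueField A)] {I : Ideal A}
    (h : SocleOne I) : SocleOne (gext I) := by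
  obtain ⟨hr, hs⟩ := h
  have key : ∀ a : GenericExt A, (∀ r ∈ maximalIdeal (GenericExt A), r * a ∈ _root_.gext I) →
      ∃ u p, IsUnit u ∧ u * a = algebraMap A[X] (GenericExt A) p ∧
        ∀ n, ∀ r ∈ maximalIdeal A, r * p.coeff n ∈ I := by
    intro a ha
    obtain ⟨u, p, hu, e⟩ := exists_unit_mul_eq _ a
    refine ⟨u, p, hu, e, fun n r hr => ?_⟩
    have h1 := Ideal.mul_mem_left _ u (ha _ (toExt_mem_maximalIdeal hr))
    rw [mul_left_comm, e, ← map_mul, mem_gext, Ideal.mem_map_C_iff] at h1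
    have := h1 n
    rwa [coeff_C_mul] at this
  refine ⟨?_, fun a b ha hb hbI => ?_⟩
  · obtain ⟨k, hk⟩ := Ideal.exists_pow_le_of_le_radical_of_fg hr (IsNoetherian.noetherian _)
    refine fun a ha => ⟨k, ?_⟩
    have h2 : maximalIdeal (GenericExt A) ^ k ≤ _root_.gext I := by
      rw [maximalIdeal_genericExt, ← Ideal.map_pow, ← Ideal.map_pow]
      exact Ideal.map_mono (Ideal.map_mono hk)
    exact h2 (Ideal.pow_mem_pow ha k)
  obtain ⟨u, p, hu, e, hp⟩ := key a ha
  obtain ⟨v, q, hv, e', hq⟩ := key b hb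
  rw [← Ideal.unit_mul_mem_iff_mem _ hv, e', mem_gext, Ideal.mem_map_C_iff, not_forall] at hbI
  obtain ⟨n, hn⟩ := hbI
  have hdec : ∀ f : A[X], (∀ n, ∀ r ∈ maximalIdeal A, r * f.coeff n ∈ I) →
      ∃ w : A[X], f - w * C (q.coeff n) ∈ I.map C := by
    intro f hf
    choose r hr using fun i => hs (f.coeff i) (q.coeff n) (hf i) (hq n) hn
    refine ⟨∑ i ∈ f.support, monomial i (r i), Ideal.mem_map_C_iff.2 fun i => ?_⟩
    rw [coeff_sub, coeff_mul_C, finsetSum_coeff]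
    simp only [coeff_monomial, Finset.sum_ite_eq', mem_support_iff]
    split_ifs with hi
    · exact hr i
    · simp [notMem_support_iff.1 hi]
  obtain ⟨w, hw⟩ := hdec p hp
  obtain ⟨w', hw'⟩ := hdec q hq
  have hw'u : IsUnit (algebraMap A[X] (GenericExt A) w') := by
    rw [isUnit_at]
    intro hmem
    have h1 := Ideal.mem_map_C_iff.1 hw' n
    rw [coeff_sub, coeff_mul_C] at h1
    have h2 := hq n _ (Ideal.mem_map_C_iff.1 hmem n)
    have := I.add_mem h1 h2
    rw [sub_add_cancel] at this
    exact hn this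
  obtain ⟨t, ht⟩ := hw'u.exists_right_inv
  obtain ⟨u', hu'⟩ := hu.exists_right_inv
  refine ⟨u' * algebraMap A[X] (GenericExt A) w * t * v, ?_⟩
  have h1 := Ideal.mem_map_of_mem (algebraMap A[X] (GenericExt A)) hw
  have h2 := Ideal.mem_map_of_mem (algebraMap A[X] (GenericExt A)) hw'
  rw [map_sub, map_mul, ← e] at h1
  rw [map_sub, map_mul, ← e'] at h2
  have h3 := Ideal.sub_mem _ (Ideal.mul_mem_left _ u' h1)
    (Ideal.mul_mem_left _ (u' * algebraMap A[X] (GenericExt A) w * t) h2)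
  convert h3 using 1
  linear_combination (-a) * hu' - u' * (algebraMap A[X] (GenericExt A) w) *
    (algebraMap A[X] (GenericExt A) (C (q.coeff n))) * ht

lemma Gor.gext [IsNoetherianRing A] [Infinite (ResidueField A)] {d : ℕ} {I : Ideal A}
    (h : Gor d I) : Gor d (gext I) := Reach.gext (fun _ hJ => SocleOne.gext hJ) h

lemma DepthGE.gext {d : ℕ} {I : Ideal A} (h : DepthGE d I) : DepthGE d (gext I) :=
  Reach.gext (fun _ _ => trivial) h

end Generic

lemma RegList.rotate_back {A : Type*} [CommRing A] [IsLocalRing A] [IsNoetherianRing A]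
    {I : Ideal A} {y : A} {l : List A} (h : RegList I (l ++ [y])) : RegList I (y :: l) := by
  induction l generalizing I with
  | nil => exact h
  | cons a l ih =>
    obtain ⟨ha, haI, hl⟩ := h
    obtain ⟨hy, hyI, hl⟩ := ih hl
    refine ⟨hy, haI.swap_left ha hyI, ha, haI.swap_right hyI, ?_⟩
    rwa [sup_right_comm]

lemma RegList.of_comap {S R : Type*} [CommRing S] [CommRing R] [IsLocalRing S] [IsLocalRing R]
    {φ : S →+* R} (hφ : Function.Surjective φ) {J : Ideal R} {l : List S}
    (h : RegList (J.comap φ) l) : RegList J (l.map φ) := by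
  induction l generalizing J with
  | nil => trivial
  | cons z l ih =>
    refine ⟨(apply_mem_maximalIdeal_iff hφ).2 h.1, (RegMod.comap hφ).1 h.2.1, ih ?_⟩
    rw [comap_sup_span hφ]
    exact h.2.2

noncomputable section Specialize

open Polynomial

variable {A : Type*} [CommRing A] [IsLocalRing A]

/-- The specialization of a local polynomial ring at `u`. -/
def specializeHom (u : A) : Localization.AtPrime (evalPrime u) →+* A :=
  IsLocalization.lift (M := (evalPrime u).primeCompl) (g := evalRingHom u) fun s => by
    have := s.2
    rwa [Ideal.mem_primeCompl_iff, Ideal.mem_comap, mem_maximalIdeal, mem_nonunits_iff,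
      not_not] at this

@[simp]
lemma specialize_algebraMap (u : A) (p : A[X]) :
    specializeHom u (algebraMap _ _ p) = p.eval u :=
  IsLocalization.lift_eq _ _

lemma specialize_comp_algebraMap (u : A) :
    (specializeHom u).comp (algebraMap A[X] _) = evalRingHom u :=
  IsLocalization.lift_comp _

lemma specialize_surjective (u : A) : Function.Surjective (specializeHom u) := fun a =>
  ⟨algebraMap _ _ (C a), by simp⟩

lemma ker_specialize (u : A) :
    RingHom.ker (specializeHom u) = Ideal.span {algebraMap A[X] _ (X - C u)} := by
  apply le_antisymm
  · intro b hb
    obtain ⟨v, p, hv, e⟩ := exists_unit_mul_eq _ b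
    have h : p.eval u = 0 := by
      rw [← specialize_algebraMap, ← e, map_mul, RingHom.mem_ker.1 hb, mul_zero]
    rw [← Ideal.unit_mul_mem_iff_mem _ hv, e, Ideal.mem_span_singleton]
    exact map_dvd _ (dvd_iff_isRoot.2 h)
  · rw [Ideal.span_singleton_le_iff_mem, RingHom.mem_ker]
    simp

lemma map_specialize (u : A) (K : Ideal A[X]) :
    (K.map (algebraMap A[X] _)).map (specializeHom u) = K.map (evalRingHom u) := by
  rw [Ideal.map_map, specialize_comp_algebraMap]

lemma map_specialize_list (u : A) (p : List A[X]) :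
    (p.map (algebraMap A[X] _)).map (specializeHom u) = p.map (eval u) := by
  simp [Function.comp_def]

lemma X_sub_C_mem_maximalIdeal (u : A) :
    algebraMap A[X] _ (X - C u) ∈ maximalIdeal (Localization.AtPrime (evalPrime u)) :=
  mem_maximalIdeal_at.2 (by simp)

lemma regMod_bot_X_sub_C (u : A) :
    RegMod (⊥ : Ideal (Localization.AtPrime (evalPrime u))) (algebraMap A[X] _ (X - C u)) := by
  have : RegMod (⊥ : Ideal A[X]) (X - C u) := fun a ha => by
    rwa [Ideal.mem_bot, (monic_X_sub_C u).mul_right_eq_zero_iff] at ha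
  simpa using regMod_at_of_forall_mul_mem (q := evalPrime u) this

variable [IsNoetherianRing A]

instance (q : Ideal A[X]) [q.IsPrime] : IsNoetherianRing (Localization.AtPrime q) :=
  IsLocalization.isNoetherianRing q.primeCompl _ inferInstance

/-- Lifting a link to polynomials. -/
lemma lift_link_specialize {u : A} {K : Ideal A[X]}
    (hK : RegMod (K.map (algebraMap A[X] (Localization.AtPrime (evalPrime u))))
      (algebraMap A[X] _ (X - C u)))
    {p : List A[X]} (hpK : Ideal.ofList p ≤ K) (hp : RegList ⊥ (p.map (eval u))) {n : ℕ}
    (hG : Gor n (Ideal.ofList (p.map (eval u)))) (hD : DepthGE n (K.map (evalRingHom u))) :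
    RegList ⊥ (p.map (algebraMap A[X] (Localization.AtPrime (evalPrime u)))) ∧
      RegMod ((Ideal.ofList p).map (algebraMap A[X] (Localization.AtPrime (evalPrime u))))
        (algebraMap A[X] _ (X - C u)) ∧
      ((Ideal.ofList p).colon (K : Set A[X])).map (evalRingHom u) =
        (Ideal.ofList (p.map (eval u))).colon (K.map (evalRingHom u) : Set A) := by
  rw [← map_specialize_list] at hp hG ⊢
  rw [← map_specialize] at hD
  have := lift_link (specialize_surjective u) (X_sub_C_mem_maximalIdeal u)
    (regMod_bot_X_sub_C u) (ker_specialize u) hK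
    (p := p.map (algebraMap A[X] _)) (by rw [← Ideal.map_ofList]; exact Ideal.map_mono hpK) hp
    hG hD
  rw [← Ideal.map_ofList] at this
  obtain ⟨h1, h2, h3⟩ := this
  refine ⟨h1, h2, ?_⟩
  rw [← map_specialize, map_colon_at (IsNoetherian.noetherian K), h3, map_specialize]

omit [IsNoetherianRing A] in
lemma comap_gext [Infinite (ResidueField A)] (I : Ideal A) :
    (gext I).comap (algebraMap A[X] (GenericExt A)) = I.map C := by
  ext p
  exact mem_gext

/-- Ideals linked to a generic extension specialize to linked ideals. -/
lemma LinkClass.eventually_specialize [Infinite (ResidueField A)] {e g : ℕ}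
    (hA : Gor (e + g) (⊥ : Ideal A)) {I : Ideal A} (hI : DepthGE e I) {I' : Ideal (GenericExt A)}
    (h : LinkClass g (gext I) I') : ∀ᶠ u in generic A,
      LinkClass g I ((I'.comap (algebraMap A[X] (GenericExt A))).map (evalRingHom u)) := by
  induction h with
  | refl => simp only [comap_gext, map_eval_map_C]; exact .of_forall fun _ => .refl
  | @tail K J _ h ih =>
    obtain ⟨l, hlg, hl, hlK, -, hKJ, -⟩ := h
    obtain ⟨p, hpl, hp, hpe⟩ := hl.exists_map
    rw [← hpe, ← Ideal.map_ofList] at hlK hKJ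
    have hpK := Ideal.map_le_iff_le_comap.1 hlK
    rw [← map_comap_at K, ← map_colon_at (IsNoetherian.noetherian _)] at hKJ
    set K₀ := K.comap (algebraMap A[X] (GenericExt A)) with hK₀
    obtain ⟨D₁, hD₁, h₁⟩ := exists_map_eq_map_of_le (q := extPrime A)
      ((Ideal.ofList p).colon (K₀ : Set A[X]))
    obtain ⟨D₂, hD₂, h₂⟩ := RegList.exists_of_le (q := extPrime A) (I := ⊥) (l := p)
      (by rwa [Ideal.map_bot])
    obtain ⟨D₃, hD₃, h₃⟩ := exists_map_eq_map_of_le (q := extPrime A) (Ideal.ofList p)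
    filter_upwards [ih, eventually_notMem_evalPrime hD₁, eventually_notMem_evalPrime hD₂,
      eventually_notMem_evalPrime hD₃] with u hu hu₁ hu₂ hu₃
    have hreg := h₂ (evalPrime u) inferInstance (extPrime_le_evalPrime u) hu₂
    rw [Ideal.map_bot] at hreg
    have ht : RegMod ((Ideal.ofList p).map (algebraMap A[X] (Localization.AtPrime (evalPrime u))))
        (algebraMap A[X] _ (X - C u)) := regMod_at.2 fun a ha =>
      ⟨D₃, hu₃, h₃ a ⟨_, X_sub_C_notMem_extPrime u, ha⟩⟩
    have hpu : RegList ⊥ (p.map (eval u)) := by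
      have := RegList.rotate_back (RegList.append_iff.2 ⟨hreg, by
        rw [bot_sup_eq, RegList.singleton_iff, ← Ideal.map_ofList]
        exact ⟨X_sub_C_mem_maximalIdeal u, ht⟩⟩)
      have := this.2.2
      rw [bot_sup_eq, ← ker_specialize] at this
      have := RegList.of_comap (J := ⊥) (specialize_surjective u) this
      rwa [map_specialize_list] at this
    have hK : RegMod (K₀.map (algebraMap A[X] (Localization.AtPrime (evalPrime u))))
        (algebraMap A[X] _ (X - C u)) := by
      refine regMod_at_of_forall_mul_mem fun a ha => ?_
      rw [hK₀, Ideal.mem_comap, map_mul] at ha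
      exact (Ideal.unit_mul_mem_iff_mem _ (isUnit_at.2 (X_sub_C_notMem_extPrime u))).1 ha
    have hdep := hu.depthGE hA hI
    have hlen : (p.map (eval u)).length = g := by simp [hpl, hlg]
    obtain ⟨-, -, hcol⟩ := lift_link_specialize hK hpK hpu (hpu.gor_ofList hA hlen) hdep
    have hle : Ideal.ofList (p.map (eval u)) ≤ K₀.map (evalRingHom u) := by
      have := Ideal.map_mono (f := evalRingHom u) hpK
      rwa [Ideal.map_ofList] at this
    have hlink := hpu.linked hA hlen hdep hle
    rw [← hcol] at hlink
    convert hu.tail hlink using 1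
    apply le_antisymm
    · rw [Ideal.map_le_iff_le_comap]
      intro a ha
      rw [← hKJ, Ideal.mem_comap, mem_map_at] at ha
      have h := Ideal.mem_map_of_mem (evalRingHom u) (h₁ a ha)
      rw [map_mul] at h
      rw [Ideal.mem_comap]
      refine (Ideal.unit_mul_mem_iff_mem _ ?_).1 h
      simpa [mem_maximalIdeal] using hu₁
    · refine Ideal.map_mono fun a ha => ?_
      rw [Ideal.mem_comap, ← hKJ]
      exact Ideal.mem_map_of_mem _ ha

lemma LinkClass.le_gext_linkSum [Infinite (ResidueField A)] {e g : ℕ}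
    (hA : Gor (e + g) (⊥ : Ideal A)) {I : Ideal A} (hI : DepthGE e I) {I' : Ideal (GenericExt A)}
    (h : LinkClass g (gext I) I') : I' ≤ gext (linkSum g I) := by
  rw [← map_comap_at I']
  refine Ideal.map_mono fun p hp => mem_map_C_of_eventually ?_
  filter_upwards [h.eventually_specialize hA hI] with u hu
  exact hu.le_linkSum (Ideal.mem_map_of_mem (evalRingHom u) hp)

end Specialize

section SectionLinks

open Polynomial

variable {A : Type*} [CommRing A]

lemma exists_list_map_eval {K : Ideal A[X]} {u : A} {l : List A}
    (h : ∀ a ∈ l, a ∈ K.map (evalRingHom u)) : ∃ p : List A[X], p.map (eval u) = l ∧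
      ∀ z ∈ p, z ∈ K := by
  induction l with
  | nil => exact ⟨[], rfl, by simp⟩
  | cons a l ih =>
    obtain ⟨p, hp, hpK⟩ := ih fun b hb => h b (by simp [hb])
    obtain ⟨z, hz, hza⟩ := (Ideal.mem_map_iff_of_surjective (evalRingHom u)
      fun a => ⟨C a, by simp⟩).1 (h a (by simp))
    refine ⟨z :: p, ?_, by simpa [hz] using hpK⟩
    rw [List.map_cons, hp, ← hza, coe_evalRingHom]

lemma exists_forall₂_sub_mem {I : Ideal A} {y : A} {l : List A}
    (h : ∀ a ∈ l, a ∈ I ⊔ Ideal.span {y}) : ∃ l' : List A, (∀ a ∈ l', a ∈ I) ∧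
      List.Forall₂ (fun a b => a - b ∈ Ideal.span {y}) l l' := by
  induction l with
  | nil => exact ⟨[], by simp, .nil⟩
  | cons a l ih =>
    obtain ⟨l', hl', hf⟩ := ih fun b hb => h b (by simp [hb])
    obtain ⟨b, hb⟩ := mem_sup_span.1 (h a (by simp))
    refine ⟨(a - y * b) :: l', by simpa [hb] using hl', .cons ?_ hf⟩
    rw [sub_sub_cancel, Ideal.mem_span_singleton]
    exact dvd_mul_right _ _

variable [IsLocalRing A]

/-- The coefficient of a lift at the section element can be made a unit. -/
lemma exists_lift_isUnit {K : Ideal A[X]} {I' : Ideal (GenericExt A)} {x' : GenericExt A}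
    (hK : K.map (algebraMap A[X] (GenericExt A)) = I' ⊔ Ideal.span {x'}) {p : A[X]} (hp : p ∈ K) :
    ∃ p' ∈ K, p'.eval 0 = p.eval 0 ∧ ∃ b, IsUnit b ∧
      algebraMap A[X] (GenericExt A) p' - b * x' ∈ I' := by
  have hp' := Ideal.mem_map_of_mem (algebraMap A[X] (GenericExt A)) hp
  rw [hK] at hp'
  obtain ⟨b, hb⟩ := mem_sup_span.1 hp'
  by_cases hbu : IsUnit b
  · exact ⟨p, hp, rfl, b, hbu, by rwa [mul_comm]⟩
  obtain ⟨v, q, hv, e⟩ := exists_unit_mul_eq _ x'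
  have hq : algebraMap A[X] (GenericExt A) q ∈ K.map (algebraMap A[X] (GenericExt A)) := by
    rw [← e, hK]
    exact Ideal.mul_mem_left _ _ (Ideal.mem_sup_right (Ideal.mem_span_singleton_self _))
  obtain ⟨s, hs, hsq⟩ := mem_map_at.1 hq
  have hX : (X : A[X]) ∉ extPrime A := by simpa using X_sub_C_notMem_extPrime (0 : A)
  refine ⟨p + X * (s * q), K.add_mem hp (K.mul_mem_left _ hsq), by simp,
    b + algebraMap A[X] (GenericExt A) (X * s) * v, ?_, ?_⟩
  · by_contra hcon
    have h1 := Ideal.sub_mem _ ((mem_maximalIdeal _).2 hcon) ((mem_maximalIdeal _).2 hbu)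
    rw [add_sub_cancel_left] at h1
    exact h1 ((isUnit_at.2 ((extPrime A).primeCompl.mul_mem hX hs)).mul hv)
  · convert hb using 1
    simp only [map_add, map_mul, ← e]
    ring

variable [IsNoetherianRing A] [Infinite (ResidueField A)] {e g : ℕ}

omit [IsNoetherianRing A] [Infinite (ResidueField A)] in
lemma gext_bot : gext (⊥ : Ideal A) = ⊥ := by rw [gext, Ideal.map_bot, Ideal.map_bot]

/-- Every ideal in the linkage class of a hypersurface section is the specialization of a
hypersurface section of an ideal in the linkage class of the generic extension. -/
lemma LinkClass.exists_generic (hA : Gor (e + 1 + g) (⊥ : Ideal A)) {I : Ideal A}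
    (hI : DepthGE (e + 1) I) {x : A} (hxm : x ∈ maximalIdeal A) (hx : RegMod I x)
    (hH : linkSum g I ⊔ Ideal.span {x} ≠ ⊤) {K : Ideal A}
    (h : LinkClass (g + 1) (I ⊔ Ideal.span {x}) K) :
    ∃ (𝒦 : Ideal A[X]) (I' : Ideal (GenericExt A)) (x' : GenericExt A),
      𝒦.map (evalRingHom 0) = K ∧
      RegMod (𝒦.map (algebraMap A[X] (Localization.AtPrime (evalPrime (0 : A)))))
        (algebraMap A[X] _ (X - C 0)) ∧
      𝒦.map (algebraMap A[X] (GenericExt A)) = I' ⊔ Ideal.span {x'} ∧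
      LinkClass g (gext I) I' ∧ RegMod I' x' ∧
      x' ∈ gext (linkSum g I ⊔ Ideal.span {x}) := by
  have hA₁ : Gor (e + (g + 1)) (⊥ : Ideal A) := by rwa [add_assoc, add_comm 1] at hA
  have hdep : DepthGE e (I ⊔ Ideal.span {x}) := hI.exchange hxm hx
  have hAx : Gor (e + 1 + g) (⊥ : Ideal (GenericExt A)) := gext_bot (A := A) ▸ hA.gext
  have hHm := gext_le_maximalIdeal (le_maximalIdeal hH)
  induction h with
  | refl =>
    refine ⟨(I ⊔ Ideal.span {x}).map C, gext I, toExt x, map_eval_map_C _ _, ?_,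
      gext_sup_span _ _, .refl, hx.gext, ?_⟩
    · refine regMod_at_of_forall_mul_mem fun a ha => mem_map_C_of_mul_mem ?_ ha
      exact X_sub_C_notMem_extPrime 0
    · exact Ideal.mem_map_of_mem _ (Ideal.mem_map_of_mem _
        (Ideal.mem_sup_right (Ideal.mem_span_singleton_self x)))
  | @tail K J hIK hKJ ih =>
    obtain ⟨𝒦, I', x', hev, ht, hsec, hI', hx', hx'H⟩ := ih
    obtain ⟨l, hlg, hl, hlK, -, hlKJ, -⟩ := hKJ
    obtain _ | ⟨a, l⟩ := l
    · simp at hlg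
    rw [← hev, ofList_le] at hlK
    obtain ⟨_ | ⟨p₁, p⟩, hpl, hp⟩ := exists_list_map_eval hlK
    · simp at hpl
    obtain ⟨p₁', hp₁', hpe, b, hb, hbI⟩ := exists_lift_isUnit hsec (hp p₁ (by simp))
    have hpl' : (p₁' :: p).map (eval 0) = a :: l := by rw [← hpl]; simp [hpe]
    have hp𝒦 : ∀ z ∈ p₁' :: p, z ∈ 𝒦 := by
      rintro z (_ | ⟨_, hz⟩)
      · exact hp₁'
      · exact hp z (List.mem_cons_of_mem _ hz)
    clear hp hpl hpe p₁
    have hp𝒦' := ofList_le.2 hp𝒦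
    have hD : DepthGE e (𝒦.map (evalRingHom 0)) := hev ▸ LinkClass.depthGE hA₁ hIK hdep
    obtain ⟨hreg₀, ht₀, hcol⟩ := lift_link_specialize ht hp𝒦' (by rwa [hpl'])
      (by rw [hpl']; exact hl.gor_ofList hA₁ hlg) hD
    rw [hpl', hev, hlKJ] at hcol
    set y := algebraMap A[X] (GenericExt A) p₁' with hy
    have hIH : 𝒦.map (algebraMap A[X] (GenericExt A)) ≤
        gext (linkSum g I ⊔ Ideal.span {x}) := by
      rw [hsec]
      refine sup_le ((hI'.le_gext_linkSum hA hI).trans ?_)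
        ((Ideal.span_singleton_le_iff_mem _).2 hx'H)
      exact Ideal.map_mono (Ideal.map_mono le_sup_left)
    have hyH : y ∈ gext (linkSum g I ⊔ Ideal.span {x}) := hIH (Ideal.mem_map_of_mem _ hp₁')
    have hsec' : 𝒦.map (algebraMap A[X] (GenericExt A)) = I' ⊔ Ideal.span {y} := by
      have := sup_span_add (z := b * x') hbI
      rw [add_sub_cancel, Ideal.span_singleton_mul_left_unit hb] at this
      rw [hsec, this]
    have hyI' : RegMod I' y := by
      have := (hx'.unit_mul hb).add hbI
      rwa [add_sub_cancel] at this
    have hreg : RegList ⊥ ((p₁' :: p).map (algebraMap A[X] (GenericExt A))) := by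
      have := RegList.of_le (q := extPrime A) (extPrime_le_evalPrime (0 : A)) (I := ⊥)
        (l := p₁' :: p) (fun z hz => mem_maximalIdeal_at.1
          (hHm (hIH (Ideal.mem_map_of_mem _ (hp𝒦 z hz))))) (by rwa [Ideal.map_bot])
      rwa [Ideal.map_bot] at this
    obtain ⟨r, hrI, hr⟩ := exists_forall₂_sub_mem (I := I') (y := y)
      (l := p.map (algebraMap A[X] (GenericExt A))) (by
        rw [← hsec']
        intro z hz
        obtain ⟨w, hw, rfl⟩ := List.mem_map.1 hz
        exact Ideal.mem_map_of_mem _ (hp𝒦 w (by simp [hw])))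
    obtain ⟨hym, hy0, hreg'⟩ := hreg
    have hr' := RegList.rotate ⟨hym, hy0, RegList.congr
      (by rw [bot_sup_eq, Ideal.span_singleton_le_iff_mem]; exact hym)
      (by rwa [bot_sup_eq]) hreg'⟩
    rw [RegList.append_iff, bot_sup_eq, RegList.singleton_iff] at hr'
    obtain ⟨hr0, -, hry⟩ := hr'
    have hrg : r.length = g := by
      have := congr_arg List.length hpl'
      rw [← hr.length_eq]
      simp only [List.map_cons, List.length_cons, List.length_map] at this hlg ⊢
      omega
    have hrI' := ofList_le.2 hrI
    have hdI' : DepthGE (e + 1) I' := hI'.depthGE hAx hI.gext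
    refine ⟨(Ideal.ofList (p₁' :: p)).colon (𝒦 : Set A[X]),
      (Ideal.ofList r).colon (I' : Set (GenericExt A)), y, hcol, ?_, ?_,
      hI'.tail (hr0.linked hAx hrg hdI' hrI'), hry.colon _, hyH⟩
    · rw [map_colon_at (IsNoetherian.noetherian _)]
      exact ht₀.colon _
    · rw [map_colon_at (IsNoetherian.noetherian _), hsec',
        ← ((hr0.gorPair hAx hrg hdI').mulExt hrI').colon_sup_span hry, Ideal.map_ofList,
        List.map_cons, Ideal.ofList_cons, forall₂_sub_mem_sup_span hr, sup_comm (Ideal.span {y})]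

/-- Linkage of hypersurface sections does not leave the hypersurface section of the sum. -/
lemma linkSum_sup_span_ge (hA : Gor (e + 1 + g) (⊥ : Ideal A)) {I : Ideal A}
    (hI : DepthGE (e + 1) I) {x : A} (hxm : x ∈ maximalIdeal A) (hx : RegMod I x) :
    linkSum (g + 1) (I ⊔ Ideal.span {x}) ≤ linkSum g I ⊔ Ideal.span {x} := by
  by_cases hH : linkSum g I ⊔ Ideal.span {x} = ⊤
  · rw [hH]; exact le_top
  refine sSup_le fun K hK f hf => ?_
  obtain ⟨𝒦, I', x', rfl, -, hsec, hI', -, hx'⟩ := hK.exists_generic hA hI hxm hx hH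
  obtain ⟨p, hp, rfl⟩ := (Ideal.mem_map_iff_of_surjective (evalRingHom 0)
      fun a => ⟨C a, by simp⟩).1 hf
  refine eval_mem_of_mem_map_C (mem_gext.1 ?_) 0
  refine sup_le ((hI'.le_gext_linkSum hA hI).trans ?_)
    ((Ideal.span_singleton_le_iff_mem _).2 hx') (hsec ▸ Ideal.mem_map_of_mem _ hp)
  exact Ideal.map_mono (Ideal.map_mono le_sup_left)

end SectionLinks

section RegularSequences

variable {A : Type*} [CommRing A] [IsLocalRing A]

lemma RegList.iff_take {I : Ideal A} {l : List A} : RegList I l ↔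
    (∀ z ∈ l, z ∈ maximalIdeal A) ∧
      ∀ (i : ℕ) (h : i < l.length), RegMod (I ⊔ Ideal.ofList (l.take i)) l[i] := by
  induction l generalizing I with
  | nil => simp [RegList]
  | cons z l ih =>
    rw [RegList, ih]
    constructor
    · rintro ⟨h1, h2, h3, h4⟩
      refine ⟨by simpa using ⟨h1, h3⟩, fun i hi => ?_⟩
      cases i with
      | zero => simpa using h2
      | succ i =>
        have := h4 i (by simpa using hi)
        rwa [sup_assoc, ← Ideal.ofList_cons] at this
    · rintro ⟨h1, h2⟩
      rw [List.forall_mem_cons] at h1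
      have h0 : RegMod I z := by
        have := h2 0 (by simp)
        rwa [List.take_zero, Ideal.ofList_nil, sup_bot_eq] at this
      refine ⟨h1.1, h0, h1.2, fun i hi => ?_⟩
      rw [sup_assoc, ← Ideal.ofList_cons]
      exact h2 (i + 1) (by simpa using hi)

lemma regList_bot_iff {l : List A} : RegList ⊥ l ↔ Sequence.IsRegular A l := by
  have hreg : ∀ (J : Ideal A) (z : A), IsSMulRegular (A ⧸ (J • ⊤ : Ideal A)) z ↔ RegMod J z := by
    intro J z
    rw [smul_eq_mul, Ideal.mul_top, regMod_iff_isSMulRegular]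
  rw [RegList.iff_take]
  constructor
  · rintro ⟨h1, h2⟩
    refine ⟨⟨fun i hi => (hreg _ _).2 (by simpa using h2 i hi)⟩, fun h => ?_⟩
    rw [smul_eq_mul, Ideal.mul_top] at h
    have := ofList_le.2 h1
    rw [← h, top_le_iff] at this
    exact Ideal.IsPrime.ne_top' this
  · rintro ⟨⟨h1⟩, h2⟩
    rw [smul_eq_mul, Ideal.mul_top] at h2
    exact ⟨ofList_le.1 (le_maximalIdeal h2.symm),
      fun i hi => by simpa using (hreg _ _).1 (h1 i hi)⟩

lemma RegList.reach {B : Ideal A → Prop} {I : Ideal A} {l : List A} (h : RegList I l)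
    (hB : B (I ⊔ Ideal.ofList l)) : Reach B l.length I := by
  induction l generalizing I with
  | nil => rwa [Ideal.ofList_nil, sup_bot_eq] at hB
  | cons z l ih =>
    refine ⟨z, h.1, h.2.1, ih h.2.2 ?_⟩
    rwa [sup_assoc, ← Ideal.ofList_cons]

end RegularSequences

section Assembly

variable {R : Type} [CommRing R]

lemma IsCMLocalRing.exists_regList [IsLocalRing R] (h : IsCMLocalRing R) :
    ∃ l : List R, RegList ⊥ l ∧ ringKrullDim R = (l.length : ℕ) := by
  rw [IsCMLocalRing, gradeOf] at h
  set s := {n : ℕ | ∃ rs : List R, rs.length = n ∧ (∀ r ∈ rs, r ∈ maximalIdeal R) ∧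
    Sequence.IsRegular R rs}
  by_cases hb : BddAbove s
  · have h0 : 0 ∈ s := ⟨[], rfl, by simp, regList_bot_iff.1 trivial⟩
    obtain ⟨l, hl, -, hr⟩ := Nat.sSup_mem ⟨0, h0⟩ hb
    exact ⟨l, regList_bot_iff.2 hr, by rw [hl]; exact h⟩
  · rw [Nat.sSup_of_not_bddAbove hb] at h
    exact ⟨[], trivial, h⟩

variable [IsLocalRing R]

lemma IsGorensteinLocalRing.exists_gor [IsNoetherianRing R] (h : IsGorensteinLocalRing R) :
    ∃ n, Gor n (⊥ : Ideal R) := by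
  obtain ⟨-, rs, hrs, hrad, hirr⟩ := h
  exact ⟨_, (regList_bot_iff.2 hrs).reach (by
    rw [bot_sup_eq]; exact SocleOne.of_infIrred hirr hrad.ge)⟩

lemma IsCMIdeal.exists_depthGE {I : Ideal R} (h : IsCMIdeal R I) :
    I ≠ ⊤ ∧ ∃ e : ℕ, DepthGE e I ∧ ringKrullDim (R ⧸ I) = e := by
  obtain ⟨hloc, h⟩ := h
  obtain ⟨l, hl, hdim⟩ := h.exists_regList
  have hI : I ≠ ⊤ := by
    rintro rfl
    exact one_ne_zero (Subsingleton.elim (1 : R ⧸ (⊤ : Ideal R)) 0)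
  refine ⟨hI, l.length, ?_, hdim⟩
  obtain ⟨p, rfl⟩ := (List.map_surjective_iff.2 (Ideal.Quotient.mk_surjective (I := I))) l
  have := (hl.comap Ideal.Quotient.mk_surjective).depthGE
  rwa [← RingHom.ker_eq_comap_bot, Ideal.mk_ker, ← List.length_map (Ideal.Quotient.mk I)] at this

variable [IsNoetherianRing R]

/-- `R ⧸ I` is Cohen-Macaulay of dimension `e`. -/
def IsCMOfDim (e : ℕ) (I : Ideal R) : Prop :=
  I ≠ ⊤ ∧ DepthGE e I ∧ ringKrullDim (R ⧸ I) ≤ e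

variable {e g : ℕ}

lemma RegList.exists_gor {n : ℕ} (hR : Gor n (⊥ : Ideal R)) {l : List R} (hl : RegList ⊥ l) :
    ∃ f, f + l.length = n ∧ Gor f (Ideal.ofList l) := by
  have h : l.length ≤ n := by
    have := (hl.depthGE.le_ringKrullDim bot_ne_top).trans hR.ringKrullDim_le
    exact_mod_cast this
  obtain ⟨f, rfl⟩ := Nat.exists_eq_add_of_le' h
  exact ⟨f, rfl, hl.gor_ofList hR rfl⟩

omit [IsLocalRing R] [IsNoetherianRing R] in
lemma IsDirectlyLinked.symm {I J : Ideal R} (h : IsDirectlyLinked R I J) :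
    IsDirectlyLinked R J I := by
  obtain ⟨hI, hJ, c, hc, hle, h1, h2⟩ := h
  exact ⟨hJ, hI, c, hc, by rwa [inf_comm], h2, h1⟩

lemma IsDirectlyLinked.linked (hR : Gor (e + g) (⊥ : Ideal R)) {I J : Ideal R}
    (h : IsDirectlyLinked R I J) (hI : IsCMOfDim e I) : Linked g I J ∧ IsCMOfDim e J := by
  obtain ⟨hI1, hJ1, c, ⟨-, l, hl, rfl⟩, hle, hJI, hIJ⟩ := h
  rw [← regList_bot_iff] at hl
  obtain ⟨f, hf, hG⟩ := hl.exists_gor hR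
  obtain ⟨s, hsJ, hs⟩ : ∃ s ∈ J, s ∉ Ideal.ofList l := by
    by_contra! hcon
    refine hI1 ((Ideal.eq_top_iff_one _).2 ?_)
    rw [← hJI, mem_ideal_colon]
    simpa using hcon
  have h1 : f ≤ e := by
    have hIs : I ≤ (Ideal.ofList l).colon {s} := fun a ha => by
      rw [← hJI, mem_ideal_colon] at ha
      rw [mem_ideal_colon_singleton]
      exact ha s hsJ
    have := ((hG.depthGE.le_ringKrullDim_colon hs).trans
      (ringKrullDim_quotient_anti hIs)).trans hI.2.2
    exact_mod_cast this
  have h2 : e ≤ f := by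
    have := ((hI.2.1.le_ringKrullDim hI1).trans
      (ringKrullDim_quotient_anti (hle.trans inf_le_left))).trans hG.ringKrullDim_le
    exact_mod_cast this
  obtain rfl := le_antisymm h1 h2
  have hlink : Linked g I J := ⟨l, by omega, hl, hle.trans inf_le_left,
    hle.trans inf_le_right, hIJ, hJI⟩
  exact ⟨hlink, hJ1, hlink.depthGE hR hI.2.1,
    (ringKrullDim_quotient_anti (hle.trans inf_le_right)).trans hG.ringKrullDim_le⟩

omit [IsNoetherianRing R] in
lemma Linked.isDirectlyLinked {I J : Ideal R} (h : Linked g I J) (hI : I ≠ ⊤) (hJ : J ≠ ⊤) :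
    IsDirectlyLinked R I J := by
  obtain ⟨l, -, hl, hlI, hlJ, h1, h2⟩ := h
  exact ⟨hI, hJ, _, ⟨ne_top_of_le_ne_top hI hlI, l, regList_bot_iff.1 hl, rfl⟩,
    le_inf hlI hlJ, h2, h1⟩

omit [IsNoetherianRing R] in
lemma Linked.isCompleteIntersectionIdeal {I : Ideal R} (h : Linked g I ⊤) :
    IsCompleteIntersectionIdeal R I := by
  obtain ⟨l, -, hl, hlI, -, -, h2⟩ := h
  have hIl : I ≤ Ideal.ofList l := fun a ha => by
    rw [← h2, mem_ideal_colon] at ha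
    simpa using ha 1 trivial
  obtain rfl := le_antisymm hIl hlI
  exact ⟨ne_top_of_le_ne_top Ideal.IsPrime.ne_top' hl.ofList_le_maximalIdeal, l,
    regList_bot_iff.1 hl, rfl⟩

lemma IsCompleteIntersectionIdeal.linked_top (hR : Gor (e + g) (⊥ : Ideal R)) {I : Ideal R}
    (h : IsCompleteIntersectionIdeal R I) (hI : IsCMOfDim e I) : Linked g I ⊤ := by
  obtain ⟨-, l, hl, rfl⟩ := h
  rw [← regList_bot_iff] at hl
  obtain ⟨f, hf, hG⟩ := hl.exists_gor hR
  have h1 : f ≤ e := by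
    have := (hG.depthGE.le_ringKrullDim hI.1).trans hI.2.2
    exact_mod_cast this
  have h2 : e ≤ f := by
    have := (hI.2.1.le_ringKrullDim hI.1).trans hG.ringKrullDim_le
    exact_mod_cast this
  refine ⟨l, by omega, hl, le_rfl, le_top, ?_, ?_⟩
  · refine (Ideal.eq_top_iff_one _).2 (mem_ideal_colon.2 ?_)
    simp
  · refine le_antisymm (fun a ha => ?_) (Ideal.le_colon)
    simpa using mem_ideal_colon.1 ha 1 trivial

lemma InSameLinkageClass.linkClass (hR : Gor (e + g) (⊥ : Ideal R)) {I J : Ideal R}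
    (h : InSameLinkageClass R I J) (hI : IsCMOfDim e I) :
    LinkClass g I J ∧ IsCMOfDim e J := by
  suffices (IsCMOfDim e I ↔ IsCMOfDim e J) ∧ (IsCMOfDim e I → LinkClass g I J) from
    ⟨this.2 hI, this.1.1 hI⟩
  clear hI
  induction h with
  | rel I J h => exact ⟨⟨fun hI => (h.linked hR hI).2, fun hJ => (h.symm.linked hR hJ).2⟩,
      fun hI => .single (h.linked hR hI).1⟩
  | refl I => exact ⟨.rfl, fun _ => .refl⟩
  | symm I J _ ih => exact ⟨ih.1.symm, fun hJ => (ih.2 (ih.1.2 hJ)).symm⟩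
  | trans I J K _ _ ih₁ ih₂ =>
    exact ⟨ih₁.1.trans ih₂.1, fun hI => (ih₁.2 hI).trans (ih₂.2 (ih₁.1.1 hI))⟩

lemma LinkClass.inSameLinkageClass (hR : Gor (e + g) (⊥ : Ideal R)) {I J : Ideal R}
    (h : LinkClass g I J) (hI : IsCMOfDim e I) (hlicci : ¬ Licci R I) :
    InSameLinkageClass R I J := by
  induction h with
  | refl => exact .refl _
  | @tail K J _ hKJ ih =>
    by_cases hJ : J = ⊤
    · subst hJ
      exact (hlicci ⟨K, ih, hKJ.isCompleteIntersectionIdeal⟩).elim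
    · exact ih.trans _ _ _ (.rel _ _ (hKJ.isDirectlyLinked (ih.linkClass hR hI).2.1 hJ))

lemma intLink_eq_linkSum (hR : Gor (e + g) (⊥ : Ideal R)) {I : Ideal R} (hI : IsCMOfDim e I) :
    intLink R I = linkSum g I := by
  rw [intLink]
  split_ifs with h
  · obtain ⟨J, hJ, hCI⟩ := h
    obtain ⟨h1, h2⟩ := hJ.linkClass hR hI
    exact (top_le_iff.1 (LinkClass.le_linkSum (h1.tail (hCI.linked_top hR h2)))).symm
  · rw [linkSum]
    congr 1
    ext J
    exact ⟨fun hJ => (hJ.linkClass hR hI).1, fun hJ => LinkClass.inSameLinkageClass hR hJ hI h⟩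

omit [IsLocalRing R] [IsNoetherianRing R] in
lemma intLink_top : intLink R ⊤ = ⊤ := by
  rw [intLink]
  split_ifs
  · rfl
  · exact top_le_iff.1 (le_sSup (Relation.EqvGen.refl _))

end Assembly

/-- Theorem 3.1, Hypersurface Section Formula. Let `I` be a
Cohen-Macaulay ideal of positive grade in a Noetherian local Gorenstein ring with
infinite residue field and let `x ∈ R` be regular on `R` and on `R/I`.  Then
`∫(I + (x)) = (∫I) + (x)`. -/
theorem statement10 (R : Type) [CommRing R] [IsLocalRing R] [IsNoetherianRing R]
    (hGor : IsGorensteinLocalRing R) (hres : Infinite (IsLocalRing.ResidueField R))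
    (I : Ideal R) (hCM : IsCMIdeal R I) (hgrade : ∃ r ∈ I, r ∈ nonZeroDivisors R)
    (x : R) (hx : IsSMulRegular R x) (hxI : IsSMulRegular (R ⧸ I) x) :
    intLink R (I ⊔ Ideal.span {x}) = intLink R I ⊔ Ideal.span {x} := by
  by_cases hxm : x ∈ maximalIdeal R
  · obtain ⟨n, hR⟩ := hGor.exists_gor
    obtain ⟨hI, e, hdep, hdim⟩ := hCM.exists_depthGE
    rw [← regMod_iff_isSMulRegular] at hxI
    have hIx : I ⊔ Ideal.span {x} ≠ ⊤ := ne_top_of_le_ne_top Ideal.IsPrime.ne_top'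
      (sup_le (le_maximalIdeal hI) ((Ideal.span_singleton_le_iff_mem _).2 hxm))
    have hle := hxI.ringKrullDim_add_one_le
    rw [hdim] at hle
    have hen : e ≤ n := by
      have := (hdim.ge.trans (ringKrullDim_quotient_anti bot_le)).trans hR.ringKrullDim_le
      exact_mod_cast this
    obtain ⟨g, rfl⟩ := Nat.exists_eq_add_of_le hen
    obtain _ | e := e
    · have : Nontrivial (R ⧸ I ⊔ Ideal.span {x}) := Ideal.Quotient.nontrivial_iff.2 hIx
      have h1 : (0 : WithBot ℕ∞) + 1 ≤ (0 : ℕ) :=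
        (add_le_add_left ringKrullDim_nonneg_of_nontrivial 1).trans hle
      norm_cast at h1
    have hR' : Gor (e + (g + 1)) (⊥ : Ideal R) := by rwa [add_assoc, add_comm 1] at hR
    rw [intLink_eq_linkSum hR ⟨hI, hdep, hdim.le⟩,
      intLink_eq_linkSum hR' ⟨hIx, hdep.exchange hxm hxI, ?_⟩]
    · exact le_antisymm (linkSum_sup_span_ge hR hdep hxm hxI)
        (linkSum_sup_span_le hR hdep hxm hxI)
    · rw [Nat.cast_succ] at hle
      exact ENat.WithBot.add_le_add_one_right_iff.1 hle
  · have hu : Ideal.span {x} = ⊤ := Ideal.span_singleton_eq_top.2 (by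
      simpa [mem_maximalIdeal] using hxm)
    rw [hu, sup_top_eq, sup_top_eq, intLink_top]
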